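/- Let I ⊂ S be a homogeneous ideal generated in degree d, of height c ≥ 2 and projective dimension p, with d-linear free resolution. Then for all 1 ≤ t ≤ p, max{ C(p,t), C(d+t−2, t−1)·C(d+c−1, c−t) } ≤ β_t(S/I) ≤ C(d+t−2, t−1)·C(d+p−1, p−t) =: C_t. Moreover, β_t(S/I) = C_t for some t if and only if β_t(S/I) = C_t for all t; and if S/I is Cohen–Macaulay then β_t(S/I) = C_t for all t. -/

import Mathlib

/-- The free graded module with `b j` generators in degree `j` (i.e. `⊕_j A(-j)^{b j}`). -/
abbrev FreeMod (A : Type*) [CommRing A] (b : ℤ → ℕ) : Type _ :=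
  ((j : ℤ) × Fin (b j)) →₀ A

/-- A minimal graded free resolution of the module `M` over the (graded) commutative ring `A`,
where `hom m` is the set of homogeneous elements of degree `m` of `A`.  The data records the
graded Betti numbers `β i j` (the number of copies of `A(-j)` in homological degree `i`),
the differentials and the augmentation; the conditions say that the differentials are graded of
degree `0` (the entries of their matrices are homogeneous of the appropriate degree), that the
resolution is minimal (all entries have positive degree, equivalently lie in the irrelevant
maximal ideal), and that the complex is exact, resolving `M`. -/
structure MinGradedFreeRes (A : Type*) [CommRing A] (hom : ℕ → Set A)
    (M : Type*) [AddCommGroup M] [Module A M] where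
  β : ℕ → ℤ → ℕ
  finβ : ∀ i, (Function.support (β i)).Finite
  d : ∀ i, FreeMod A (β (i + 1)) →ₗ[A] FreeMod A (β i)
  aug : FreeMod A (β 0) →ₗ[A] M
  graded : ∀ (i : ℕ) (j : ℤ) (a : Fin (β (i + 1) j)) (j' : ℤ) (a' : Fin (β i j')),
      d i (Finsupp.single ⟨j, a⟩ 1) ⟨j', a'⟩ = 0 ∨
      ∃ m : ℕ, (m : ℤ) = j - j' ∧ d i (Finsupp.single ⟨j, a⟩ 1) ⟨j', a'⟩ ∈ hom m
  minimal : ∀ (i : ℕ) (j : ℤ) (a : Fin (β (i + 1) j)) (j' : ℤ) (a' : Fin (β i j')),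
      d i (Finsupp.single ⟨j, a⟩ 1) ⟨j', a'⟩ ≠ 0 → j' < j
  augSurj : Function.Surjective aug
  exact₀ : LinearMap.range (d 0) = LinearMap.ker aug
  exact : ∀ i, LinearMap.range (d (i + 1)) = LinearMap.ker (d i)

/-- The `i`-th total Betti number of a resolution. -/
noncomputable def MinGradedFreeRes.tB {A : Type*} [CommRing A] {hom : ℕ → Set A}
    {M : Type*} [AddCommGroup M] [Module A M]
    (res : MinGradedFreeRes A hom M) (i : ℕ) : ℕ :=
  ∑ j ∈ (res.finβ i).toFinset, res.β i j

/-- The height of an ideal: the infimum of the heights of the primes containing it. -/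
noncomputable def idealHeight {A : Type*} [CommRing A] (I : Ideal A) : ℕ∞ :=
  ⨅ (P : PrimeSpectrum A) (_ : I ≤ P.asIdeal), Order.height P

/-- The depth of a module over `k[x₁,…,xₙ]` with respect to the irrelevant maximal ideal. -/
noncomputable def gradedDepth (k : Type) [Field k] (n : ℕ) (M : Type) [AddCommGroup M]
    [Module (MvPolynomial (Fin n) k) M] : ℕ∞ :=
  sSup {r : ℕ∞ | ∃ rs : List (MvPolynomial (Fin n) k), (rs.length : ℕ∞) = r ∧
    (∀ x ∈ rs, MvPolynomial.constantCoeff x = 0) ∧ RingTheory.Sequence.IsRegular M rs}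

/-- The Krull dimension of a module: the dimension of `S / ann(M)`. -/
noncomputable def moduleDim (k : Type) [Field k] (n : ℕ) (M : Type) [AddCommGroup M]
    [Module (MvPolynomial (Fin n) k) M] : WithBot ℕ∞ :=
  ringKrullDim (MvPolynomial (Fin n) k ⧸ Module.annihilator (MvPolynomial (Fin n) k) M)


section
open MvPolynomial

namespace BB

/-- the linear form on the moment curve -/
noncomputable def ll {k : Type} [Field k] (N : ℕ) (s : k) : MvPolynomial (Fin N) k :=
  ∑ a : Fin N, C (s ^ (a : ℕ)) * X a

noncomputable def ph {k : Type} [Field k] (N : ℕ) (s : k) :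
    MvPolynomial (Fin (N+1)) k →ₐ[k] MvPolynomial (Fin N) k :=
  aeval (fun a : Fin (N+1) =>
    (Fin.cons 0 X : Fin (N+1) → MvPolynomial (Fin N) k) a
      - C s * (Fin.snoc X 0 : Fin (N+1) → MvPolynomial (Fin N) k) a)

noncomputable def ps {k : Type} [Field k] (N : ℕ) (s : k) :
    MvPolynomial (Fin N) k →ₐ[k] MvPolynomial (Fin (N+1)) k :=
  aeval (fun a : Fin N => ∑ b : Fin (N+1), if (a:ℕ) < b then C (s ^ ((b:ℕ) - a - 1)) * X b else 0)

variable {k : Type} [Field k] {N : ℕ}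

lemma ll_hom (s : k) : (ll N s).IsHomogeneous 1 := by
  refine IsHomogeneous.sum _ _ _ (fun a _ => ?_)
  exact (isHomogeneous_X k a).C_mul _

lemma ph_ll (s t : k) : ph N t (ll (N+1) s) = C (s - t) * ll N s := by
  have h1 : ph N t (ll (N+1) s) = ∑ a : Fin (N+1), C (s^(a:ℕ)) *
      (Fin.cons 0 X : Fin (N+1) → MvPolynomial (Fin N) k) a
      - ∑ a : Fin (N+1), C (s^(a:ℕ)) * (C t * (Fin.snoc X 0 : Fin (N+1) → MvPolynomial (Fin N) k) a) := by
    simp only [ll, ph, map_sum, map_mul, aeval_X, algHom_C, algebraMap_eq, mul_sub, Finset.sum_sub_distrib]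
  rw [h1, Fin.sum_univ_succ, Fin.sum_univ_castSucc (n := N)]
  simp only [Fin.cons_zero, Fin.cons_succ, Fin.snoc_castSucc, Fin.snoc_last, Fin.val_succ, Fin.val_castSucc]
  simp only [ll, Finset.mul_sum, mul_zero, zero_add, add_zero, ← Finset.sum_sub_distrib]
  refine Finset.sum_congr rfl fun a _ => ?_
  simp only [C_sub, C_pow]; ring

lemma ph_hom (s : k) {f : MvPolynomial (Fin (N+1)) k} {e : ℕ} (h : f.IsHomogeneous e) :
    (ph N s f).IsHomogeneous e := by
  have := h.aeval (n := 1) (fun a : Fin (N+1) =>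
    (Fin.cons 0 X : Fin (N+1) → MvPolynomial (Fin N) k) a
      - C s * (Fin.snoc X 0 : Fin (N+1) → MvPolynomial (Fin N) k) a) (fun a => by
      refine IsHomogeneous.sub ?_ (IsHomogeneous.C_mul ?_ _)
      · refine Fin.cases ?_ (fun i => ?_) a
        · simpa using isHomogeneous_zero _ _ _
        · simpa using isHomogeneous_X _ _
      · refine Fin.lastCases ?_ (fun i => ?_) a
        · simpa using isHomogeneous_zero _ _ _
        · simpa using isHomogeneous_X _ _)
  simpa [ph] using this

lemma ps_hom (s : k) {f : MvPolynomial (Fin N) k} {e : ℕ} (h : f.IsHomogeneous e) :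
    (ps N s f).IsHomogeneous e := by
  have := h.aeval (n := 1) (fun a : Fin N => ∑ b : Fin (N+1), if (a:ℕ) < b then C (s ^ ((b:ℕ) - a - 1)) * X b else (0 : MvPolynomial (Fin (N+1)) k)) (fun a => by
      refine IsHomogeneous.sum _ _ _ (fun b _ => ?_)
      split_ifs
      · exact IsHomogeneous.C_mul (isHomogeneous_X _ _) _
      · exact isHomogeneous_zero _ _ _)
  simpa [ps] using this

lemma ps_ph_X (s : k) (a : Fin (N+1)) :
    X a - ps N s (ph N s (X a)) = if a = 0 then ll (N+1) s else 0 := by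
  have e1 : ps N s (ph N s (X a)) = ps N s ((Fin.cons 0 X : Fin (N+1) → MvPolynomial (Fin N) k) a)
      - C s * ps N s ((Fin.snoc X 0 : Fin (N+1) → MvPolynomial (Fin N) k) a) := by
    simp [ph]
  have e2 : C s * ps N s ((Fin.snoc X 0 : Fin (N+1) → MvPolynomial (Fin N) k) a) =
      ∑ b : Fin (N+1), if (a:ℕ) < b then C (s ^ ((b:ℕ) - a)) * X b else 0 := by
    refine Fin.lastCases ?_ (fun i => ?_) a
    · simp only [Fin.snoc_last, map_zero, mul_zero]
      symm
      refine Finset.sum_eq_zero fun b _ => ?_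
      rw [if_neg]; have := b.2; simp; omega
    · simp only [Fin.snoc_castSucc, ps, aeval_X, Finset.mul_sum, Fin.val_castSucc]
      refine Finset.sum_congr rfl fun b _ => ?_
      split_ifs with hb
      · obtain ⟨c, hc⟩ := Nat.exists_eq_add_of_lt hb
        have h1 : (b:ℕ) - i - 1 = c := by omega
        have h2 : (b:ℕ) - i = c + 1 := by omega
        rw [h1, h2, pow_succ, C_mul]; ring
      · simp
  rw [e1, e2]
  refine Fin.cases ?_ (fun i => ?_) a
  · simp only [Fin.cons_zero, map_zero, zero_sub, sub_neg_eq_add, if_true, ll]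
    rw [Fin.sum_univ_succ, Fin.sum_univ_succ (n := N)]
    simp
  · rw [if_neg (Fin.succ_ne_zero i)]
    simp only [Fin.cons_succ, ps, aeval_X, Fin.val_succ]
    rw [← Finset.sum_sub_distrib, sub_eq_zero]
    rw [Finset.sum_eq_single i.succ]
    · simp
    · intro b _ hb
      have hb' : (b:ℕ) ≠ i + 1 := fun h => hb (Fin.ext (by simpa using h))
      by_cases h : (i:ℕ) < b
      · rw [if_pos h, if_pos (by omega), Nat.sub_sub, sub_self]
      · rw [if_neg h, if_neg (by omega), sub_self]
    · simp

lemma sub_ps_ph_mem (s : k) (f : MvPolynomial (Fin (N+1)) k) :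
    f - ps N s (ph N s f) ∈ Ideal.span {ll (N+1) s} := by
  have : (Ideal.Quotient.mkₐ k (Ideal.span {ll (N+1) s})) =
      ((Ideal.Quotient.mkₐ k (Ideal.span {ll (N+1) s})).comp (ps N s)).comp (ph N s) := by
    apply MvPolynomial.algHom_ext
    intro a
    simp only [AlgHom.comp_apply, Ideal.Quotient.mkₐ_eq_mk]
    rw [Ideal.Quotient.mk_eq_mk_iff_sub_mem, ps_ph_X]
    split_ifs
    · exact Ideal.mem_span_singleton_self _
    · exact zero_mem _
  have h := DFunLike.congr_fun this f
  simp only [AlgHom.comp_apply, Ideal.Quotient.mkₐ_eq_mk] at h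
  rwa [Ideal.Quotient.mk_eq_mk_iff_sub_mem] at h

lemma ph_ll_self (s : k) : ph N s (ll (N+1) s) = 0 := by simp [ph_ll]

lemma ll_dvd_iff (s : k) (f : MvPolynomial (Fin (N+1)) k) : ll (N+1) s ∣ f ↔ ph N s f = 0 := by
  constructor
  · rintro ⟨q, rfl⟩; simp [ph_ll_self]
  · intro h
    have := sub_ps_ph_mem s f
    rwa [h, map_zero, sub_zero, Ideal.mem_span_singleton] at this

lemma ph_ps (s : k) (f : MvPolynomial (Fin N) k) : ph N s (ps N s f) = f := by
  have : (ph N s).comp (ps N s) = AlgHom.id k _ := by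
    apply MvPolynomial.algHom_ext
    intro a
    -- use the relation for `X a.succ`, then telescoping
    suffices H : ∀ m : ℕ, ∀ a : Fin N, N - 1 - (a:ℕ) = m → ph N s (ps N s (X a)) = X a by
      simpa using H _ a rfl
    intro m
    induction m with
    | zero =>
      intro a ha
      have h1 : X a.succ - ps N s (ph N s (X a.succ)) = 0 := by
        rw [ps_ph_X, if_neg (Fin.succ_ne_zero a)]
      have hl : a.succ = Fin.last N := by apply Fin.ext; simp; have := a.2; omega
      have h2 : ph N s (X a.succ) = X a := by
        simp only [ph, aeval_X, Fin.cons_succ]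
        rw [hl, Fin.snoc_last]; simp
      have h3 := congrArg (ph N s) h1
      rw [map_sub, h2, map_zero, sub_eq_zero] at h3
      exact h3.symm
    | succ m ih =>
      intro a ha
      have hlt : (a:ℕ) + 1 < N := by omega
      have h1 : X a.succ - ps N s (ph N s (X a.succ)) = 0 := by
        rw [ps_ph_X, if_neg (Fin.succ_ne_zero a)]
      have hl : a.succ = Fin.castSucc ⟨a+1, hlt⟩ := by apply Fin.ext; simp
      have h2 : ph N s (X a.succ) = X a - C s * X ⟨a+1, hlt⟩ := by
        simp only [ph, aeval_X, Fin.cons_succ]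
        rw [hl, Fin.snoc_castSucc]
      have h3 := congrArg (ph N s) h1
      rw [map_sub, h2, map_zero, map_sub, map_sub, map_mul, map_mul, ih ⟨a+1, hlt⟩ (by simp; omega)] at h3
      simp only [algHom_C, algebraMap_eq] at h3
      linear_combination -h3
  exact DFunLike.congr_fun this f

lemma ll_ne_zero (s : k) : ll (N+1) s ≠ 0 := by
  intro h
  have := congrArg (coeff (Finsupp.single (0 : Fin (N+1)) 1)) h
  simp only [ll, coeff_sum, coeff_C_mul, coeff_X, coeff_zero] at this
  rw [Finset.sum_eq_single 0] at this
  · simp at this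
  · intro b _ hb
    rw [if_neg, mul_zero]
    intro hh
    exact hb ((Finsupp.single_left_injective (one_ne_zero)) hh)
  · simp

/-- division of homogeneous polynomials -/
lemma hom_div {σ : Type} {l f : MvPolynomial σ k} {e : ℕ} (hl : l.IsHomogeneous 1)
    (hf : f.IsHomogeneous (e+1)) (h : l ∣ f) : ∃ q : MvPolynomial σ k, q.IsHomogeneous e ∧ f = l * q := by
  obtain ⟨q, rfl⟩ := h
  refine ⟨homogeneousComponent e q, homogeneousComponent_isHomogeneous _ _, ?_⟩
  classical
  have key : homogeneousComponent (e+1) (l * q) = l * homogeneousComponent e q := by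
    ext m
    rw [coeff_homogeneousComponent, coeff_mul, coeff_mul]
    by_cases hm : m.degree = e + 1
    · rw [if_pos hm]
      refine Finset.sum_congr rfl fun x hx => ?_
      rw [Finset.HasAntidiagonal.mem_antidiagonal] at hx
      rw [coeff_homogeneousComponent]
      by_cases h1 : x.1.degree = 1
      · rw [if_pos]
        have := congrArg Finsupp.degree hx
        rw [map_add] at this; omega
      · rw [hl.coeff_eq_zero h1]; simp
    · rw [if_neg hm]
      symm
      refine Finset.sum_eq_zero fun x hx => ?_
      rw [Finset.HasAntidiagonal.mem_antidiagonal] at hx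
      rw [coeff_homogeneousComponent]
      by_cases h1 : x.1.degree = 1
      · rw [if_neg, mul_zero]
        have := congrArg Finsupp.degree hx
        rw [map_add] at this; omega
      · rw [hl.coeff_eq_zero h1]; simp
  rw [← key, homogeneousComponent_eq_self hf]

lemma hom_div0 {σ : Type} {l f : MvPolynomial σ k} (hl : l.IsHomogeneous 1)
    (hf : f.IsHomogeneous 0) (h : l ∣ f) : f = 0 := by
  obtain ⟨q, rfl⟩ := h
  by_contra hne
  have h1 : l ≠ 0 := left_ne_zero_of_mul hne
  have h2 : q ≠ 0 := right_ne_zero_of_mul hne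
  have := totalDegree_mul_of_isDomain h1 h2
  rw [hf.totalDegree hne, hl.totalDegree h1] at this
  omega

end BB

end

section
open MvPolynomial

namespace BB

/-- `f` is homogeneous with shifted degree. -/
def Hm {k : Type} [Field k] {N : ℕ} (f : MvPolynomial (Fin N) k) (P : Prop) (x y : ℕ) : Prop :=
  ∀ m, coeff m f ≠ 0 → P ∧ m.degree + x = y

lemma Hm_iff {k : Type} [Field k] {N : ℕ} (f : MvPolynomial (Fin N) k) (P : Prop) (x y : ℕ) :
    Hm f P x y ↔ f = 0 ∨ ∃ q, P ∧ q + x = y ∧ f.IsHomogeneous q := by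
  constructor
  · intro h
    by_cases hf : f = 0
    · exact Or.inl hf
    · right
      obtain ⟨m, hm⟩ := MvPolynomial.ne_zero_iff.1 hf
      obtain ⟨hP, h1⟩ := h m hm
      refine ⟨m.degree, hP, h1, ?_⟩
      intro m' hm'
      have := (h m' hm').2
      have h3 : Finsupp.weight (fun _ => 1) m' = m'.degree :=
        (DFunLike.congr_fun (Finsupp.degree_eq_weight_one (R := ℕ)) m').symm
      refine Eq.trans h3 ?_
      omega
  · rintro (rfl | ⟨q, hP, h1, h2⟩) m hm
    · simp at hm
    · refine ⟨hP, ?_⟩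
      by_contra hne
      exact hm (h2.coeff_eq_zero (by omega))

lemma Hm_zero {k : Type} [Field k] {N : ℕ} (P : Prop) (x y : ℕ) :
    Hm (0 : MvPolynomial (Fin N) k) P x y := by intro m hm; simp at hm

structure Cx (k : Type) [Field k] (N D : ℕ) (ι : Type) [Fintype ι] where
  g : ι → ℕ
  deg : ι → ℕ
  A : Matrix ι ι (MvPolynomial (Fin N) k)
  hom : ∀ a b, Hm (A a b) (g b = g a + 1) (deg a) (deg b)
  sq : A * A = 0
  deg_le : ∀ a, deg a ≤ D + g a

set_option linter.unusedSectionVars false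
variable {k : Type} [Field k] {N D : ℕ} {ι : Type} [Fintype ι]

namespace Cx

def bh (C : Cx k N D ι) (i e : ℕ) : Submodule k (ι → MvPolynomial (Fin N) k) where
  carrier := {v | ∀ a, Hm (v a) (C.g a = i) (C.deg a) e}
  zero_mem' := fun a => Hm_zero _ _ _
  add_mem' := by
    intro v w hv hw a m hm
    by_cases h : coeff m (v a) = 0
    · refine hw a m ?_
      intro h2; apply hm; simp [h, h2]
    · exact hv a m h
  smul_mem' := by
    intro c v hv a m hm
    refine hv a m ?_
    intro h2; apply hm; simp [h2]

lemma mem_bh {C : Cx k N D ι} {i e : ℕ} {v : ι → MvPolynomial (Fin N) k} :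
    v ∈ C.bh i e ↔ ∀ a, Hm (v a) (C.g a = i) (C.deg a) e := Iff.rfl

open Classical in
noncomputable def pr (C : Cx k N D ι) (i e : ℕ) (w : ι → MvPolynomial (Fin N) k) :
    ι → MvPolynomial (Fin N) k :=
  fun a => if C.g a = i ∧ C.deg a ≤ e then homogeneousComponent (e - C.deg a) (w a) else 0

open Classical in
lemma coeff_pr (C : Cx k N D ι) (i e : ℕ) (w : ι → MvPolynomial (Fin N) k) (a : ι) (m) :
    coeff m (C.pr i e w a) = if C.g a = i ∧ m.degree + C.deg a = e then coeff m (w a) else 0 := by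
  unfold pr
  split_ifs with h1 h2 h2
  · rw [coeff_homogeneousComponent, if_pos (by omega)]
  · rw [coeff_homogeneousComponent, if_neg (by omega)]
  · exact absurd ⟨h2.1, by omega⟩ h1
  · simp

lemma pr_mem (C : Cx k N D ι) (i e : ℕ) (w : ι → MvPolynomial (Fin N) k) :
    C.pr i e w ∈ C.bh i e := by
  classical
  intro a m hm
  rw [coeff_pr] at hm
  by_contra h
  rw [if_neg h] at hm
  exact hm rfl

lemma pr_eq (C : Cx k N D ι) {i e : ℕ} {w : ι → MvPolynomial (Fin N) k} (h : w ∈ C.bh i e) :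
    C.pr i e w = w := by
  classical
  funext a
  ext m
  rw [coeff_pr]
  split_ifs with h1
  · rfl
  · by_contra h2
    exact h1 (h a m (Ne.symm h2))

lemma A_pr (C : Cx k N D ι) (i e : ℕ) (w : ι → MvPolynomial (Fin N) k) :
    C.A.mulVec (C.pr (i+1) e w) = C.pr i e (C.A.mulVec w) := by
  classical
  funext a
  ext m
  rw [coeff_pr]
  simp only [Matrix.mulVec, dotProduct, coeff_sum, coeff_mul]
  have key : ∀ b, ∀ x ∈ Finset.HasAntidiagonal.antidiagonal m,
      coeff x.1 (C.A a b) * coeff x.2 (C.pr (i+1) e w b) =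
      if C.g a = i ∧ m.degree + C.deg a = e then coeff x.1 (C.A a b) * coeff x.2 (w b) else 0 := by
    intro b x hx
    rw [Finset.HasAntidiagonal.mem_antidiagonal] at hx
    have hdeg := congrArg Finsupp.degree hx
    rw [map_add] at hdeg
    by_cases h0 : coeff x.1 (C.A a b) = 0
    · simp [h0]
    · obtain ⟨h1, h2⟩ := C.hom a b _ h0
      rw [coeff_pr]
      by_cases h : C.g a = i ∧ m.degree + C.deg a = e
      · rw [if_pos h, if_pos ⟨by omega, by omega⟩]
      · rw [if_neg h, if_neg, mul_zero]
        rintro ⟨h3, h4⟩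
        exact h ⟨by omega, by omega⟩
  rw [Finset.sum_congr rfl fun b _ => Finset.sum_congr rfl (key b)]
  split_ifs <;> simp

lemma A_mem (C : Cx k N D ι) {i e : ℕ} {w : ι → MvPolynomial (Fin N) k} (h : w ∈ C.bh (i+1) e) :
    C.A.mulVec w ∈ C.bh i e := by
  rw [← C.pr_eq h, C.A_pr]
  exact C.pr_mem _ _ _

lemma wit (C : Cx k N D ι) {i e : ℕ} {v : ι → MvPolynomial (Fin N) k} (h : v ∈ C.bh i e)
    (h2 : ∃ w, C.A.mulVec w = v) : ∃ w ∈ C.bh (i+1) e, C.A.mulVec w = v := by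
  obtain ⟨w, hw⟩ := h2
  exact ⟨C.pr (i+1) e w, C.pr_mem _ _ _, by rw [C.A_pr, hw, C.pr_eq h]⟩

lemma AA (C : Cx k N D ι) (v : ι → MvPolynomial (Fin N) k) : C.A.mulVec (C.A.mulVec v) = 0 := by
  rw [Matrix.mulVec_mulVec, C.sq, Matrix.zero_mulVec]

lemma mul_mem (C : Cx k N D ι) {i e q : ℕ} {v : ι → MvPolynomial (Fin N) k} (h : v ∈ C.bh i e)
    {f : MvPolynomial (Fin N) k} (hf : f.IsHomogeneous q) : f • v ∈ C.bh i (e+q) := by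
  intro a
  rw [Hm_iff]
  rcases (Hm_iff _ _ _ _).1 (h a) with h1 | ⟨r, h1, h2, h3⟩
  · left; simp [h1]
  · right
    refine ⟨q + r, h1, by omega, ?_⟩
    simpa using hf.mul h3

lemma Hm_map {N' : ℕ} (φ : MvPolynomial (Fin N) k →ₐ[k] MvPolynomial (Fin N') k)
    (hφ : ∀ f e, f.IsHomogeneous e → (φ f).IsHomogeneous e) {f : MvPolynomial (Fin N) k}
    {P : Prop} {x y : ℕ} (h : Hm f P x y) : Hm (φ f) P x y := by
  rw [Hm_iff] at h ⊢
  rcases h with rfl | ⟨q, h1, h2, h3⟩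
  · left; simp
  · right; exact ⟨q, h1, h2, hφ _ _ h3⟩

noncomputable def sec (C : Cx k (N+1) D ι) (s : k) : Cx k N D ι where
  g := C.g
  deg := C.deg
  A := C.A.map (ph N s)
  hom := fun a b => Hm_map _ (fun _ _ h => ph_hom s h) (C.hom a b)
  sq := by
    have := congrArg (fun M : Matrix ι ι (MvPolynomial (Fin (N+1)) k) => M.map (ph N s)) C.sq
    simp only [Matrix.map_mul] at this
    rw [this]; ext; simp
  deg_le := C.deg_le

lemma sec_mulVec (C : Cx k (N+1) D ι) (s : k) (v : ι → MvPolynomial (Fin (N+1)) k) :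
    (C.sec s).A.mulVec (ph N s ∘ v) = ph N s ∘ (C.A.mulVec v) := by
  funext a
  simp [sec, Matrix.mulVec, dotProduct]

lemma sec_mem (C : Cx k (N+1) D ι) (s : k) {i e : ℕ} {v : ι → MvPolynomial (Fin (N+1)) k}
    (h : v ∈ C.bh i e) : ph N s ∘ v ∈ (C.sec s).bh i e :=
  fun a => Hm_map _ (fun _ _ h => ph_hom s h) (h a)

lemma sec_lift (C : Cx k (N+1) D ι) (s : k) {i e : ℕ} {v : ι → MvPolynomial (Fin N) k}
    (h : v ∈ (C.sec s).bh i e) : ∃ w ∈ C.bh i e, ph N s ∘ w = v := by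
  refine ⟨ps N s ∘ v, fun a => Hm_map _ (fun _ _ h => ps_hom s h) (h a), ?_⟩
  funext a
  simp [ph_ps]

lemma sec_div (C : Cx k (N+1) D ι) (s : k) {i e : ℕ} {v : ι → MvPolynomial (Fin (N+1)) k}
    (h : v ∈ C.bh i (e+1)) (h0 : ph N s ∘ v = 0) : ∃ w ∈ C.bh i e, v = ll (N+1) s • w := by
  have : ∀ a, ∃ f, Hm f (C.g a = i) (C.deg a) e ∧ v a = ll (N+1) s * f := by
    intro a
    have hd : ll (N+1) s ∣ v a := (ll_dvd_iff s _).2 (congrFun h0 a)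
    rcases (Hm_iff _ _ _ _).1 (h a) with h1 | ⟨r, h1, h2, h3⟩
    · exact ⟨0, Hm_zero _ _ _, by simp [h1]⟩
    · rcases r with _ | r
      · exact ⟨0, Hm_zero _ _ _, by simp [hom_div0 (ll_hom s) h3 hd]⟩
      · obtain ⟨q, hq, hq2⟩ := hom_div (ll_hom s) h3 hd
        exact ⟨q, (Hm_iff _ _ _ _).2 (Or.inr ⟨r, h1, by omega, hq⟩), hq2⟩
  choose w hw using this
  exact ⟨w, fun a => (hw a).1, funext fun a => (hw a).2⟩

lemma smul_cancel {l : MvPolynomial (Fin N) k} (hl : l ≠ 0) {v w : ι → MvPolynomial (Fin N) k}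
    (h : l • v = l • w) : v = w := by
  funext a
  have := congrFun h a
  exact mul_left_cancel₀ hl this

lemma step (C : Cx k (N+1) D ι) (s : k) (i e : ℕ)
    (H1 : ∀ w ∈ C.bh i e, (∃ v, C.A.mulVec v = ll (N+1) s • w) → C.A.mulVec w = 0 →
      ∃ z, C.A.mulVec z = w)
    (H2 : ∀ v ∈ C.bh (i+1) (e+1), C.A.mulVec v = 0 → ∃ z, C.A.mulVec z = v)
    (v' : ι → MvPolynomial (Fin N) k) (hv' : v' ∈ (C.sec s).bh (i+1) (e+1))
    (h0 : (C.sec s).A.mulVec v' = 0) : ∃ z, (C.sec s).A.mulVec z = v' := by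
  obtain ⟨v, hv, rfl⟩ := C.sec_lift s hv'
  rw [sec_mulVec] at h0
  obtain ⟨w, hw, hw2⟩ := C.sec_div s (C.A_mem hv) h0
  have hw3 : C.A.mulVec w = 0 := by
    apply smul_cancel (ll_ne_zero (N := N) s)
    rw [← Matrix.mulVec_smul, ← hw2, C.AA, smul_zero]
  obtain ⟨z, hz, hz2⟩ := C.wit hw (H1 w hw ⟨v, hw2⟩ hw3)
  obtain ⟨y, hy⟩ := H2 (v - ll (N+1) s • z) (Submodule.sub_mem _ hv (C.mul_mem hz (ll_hom s))) (by
    rw [Matrix.mulVec_sub, Matrix.mulVec_smul, hz2, hw2, sub_self])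
  refine ⟨ph N s ∘ y, ?_⟩
  rw [sec_mulVec, hy]
  funext a
  simp [ph_ll_self]

def ex (C : Cx k N D ι) (j : ℕ) : Prop :=
  ∀ i, j < i → ∀ e, D + i < e → ∀ v ∈ C.bh i e, C.A.mulVec v = 0 → ∃ w, C.A.mulVec w = v

lemma ex_sec (C : Cx k (N+1) D ι) (s : k) {j : ℕ} (h : C.ex j) : (C.sec s).ex (j+1) := by
  intro i hi e he v hv h0
  obtain ⟨i, rfl⟩ : ∃ i', i = i' + 1 := ⟨i - 1, by omega⟩
  obtain ⟨e, rfl⟩ : ∃ e', e = e' + 1 := ⟨e - 1, by omega⟩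
  refine C.step s i e ?_ ?_ v hv h0
  · intro w hw _ h1
    exact h i (by omega) e (by omega) w hw h1
  · intro w hw h1
    exact h (i+1) (by omega) (e+1) (by omega) w hw h1

/-- No socle in high degrees. -/
lemma soc : ∀ (N : ℕ) (C : Cx k N D ι) (j e : ℕ) (_ : C.ex j) (_ : D + j < e)
    (u : ι → MvPolynomial (Fin N) k) (_ : u ∈ C.bh j e)
    (_ : ∀ a : Fin N, ∃ z, C.A.mulVec z = (X a : MvPolynomial (Fin N) k) • u),
    ∃ z, C.A.mulVec z = u := by
  intro N
  induction N with
  | zero =>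
    intro C j e _ he u hu _
    refine ⟨0, ?_⟩
    rw [Matrix.mulVec_zero]
    symm
    funext a
    ext m
    by_contra hm
    have := hu a m (by simpa using hm)
    have h2 := C.deg_le a
    have h3 : m = 0 := Subsingleton.elim _ _
    rw [h3] at this
    simp at this
    omega
  | succ N ih =>
    intro C j e hex he u hu hsoc
    have hlin : ∀ f : MvPolynomial (Fin (N+1)) k, f.IsHomogeneous 1 →
        ∃ z ∈ C.bh (j+1) (e+1), C.A.mulVec z = f • u := by
      intro f hf
      refine C.wit (C.mul_mem hu hf) ?_
      have hf2 : f ∈ Submodule.span k (Set.range (X : Fin (N+1) → MvPolynomial (Fin (N+1)) k)) := by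
        rw [← homogeneousSubmodule_one_eq_span_X]; exact hf
      induction hf2 using Submodule.span_induction with
      | mem x hx => obtain ⟨a, rfl⟩ := hx; exact hsoc a
      | zero => exact ⟨0, by simp⟩
      | add x y hx hy h1 h2 =>
        have hx' : x.IsHomogeneous 1 := by
          have : x ∈ homogeneousSubmodule (Fin (N+1)) k 1 := by
            rw [homogeneousSubmodule_one_eq_span_X]; exact hx
          exact this
        have hy' : y.IsHomogeneous 1 := by
          have : y ∈ homogeneousSubmodule (Fin (N+1)) k 1 := by
            rw [homogeneousSubmodule_one_eq_span_X]; exact hy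
          exact this
        obtain ⟨z1, h1⟩ := h1 hx'
        obtain ⟨z2, h2⟩ := h2 hy'
        exact ⟨z1 + z2, by rw [Matrix.mulVec_add, h1, h2, add_smul]⟩
      | smul c x hx h1 =>
        have hx' : x.IsHomogeneous 1 := by
          have : x ∈ homogeneousSubmodule (Fin (N+1)) k 1 := by
            rw [homogeneousSubmodule_one_eq_span_X]; exact hx
          exact this
        obtain ⟨z1, h1⟩ := h1 hx'
        exact ⟨(MvPolynomial.C c : MvPolynomial (Fin (N+1)) k) • z1, by rw [Matrix.mulVec_smul, h1, smul_smul, smul_eq_C_mul]⟩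
    obtain ⟨v, hv, hv2⟩ := hlin _ (ll_hom (0 : k))
    obtain ⟨y', hy'⟩ := ih (C.sec 0) (j+1) (e+1) (C.ex_sec 0 hex) (by omega) (ph N 0 ∘ v)
      (C.sec_mem 0 hv) (by
        intro a
        obtain ⟨z, hz, hz2⟩ := hlin (ps N 0 (X a)) (ps_hom 0 (isHomogeneous_X _ _))
        obtain ⟨y, hy⟩ := hex (j+1) (by omega) (e+1+1) (by omega)
          (ps N 0 (X a) • v - ll (N+1) (0:k) • z)
          (Submodule.sub_mem _ (C.mul_mem hv (ps_hom 0 (isHomogeneous_X _ _)))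
            (C.mul_mem hz (ll_hom 0))) (by
              rw [Matrix.mulVec_sub, Matrix.mulVec_smul, Matrix.mulVec_smul, hv2, hz2, smul_smul,
                smul_smul, mul_comm, sub_self])
        refine ⟨ph N 0 ∘ y, ?_⟩
        rw [sec_mulVec, hy]
        funext b
        simp [ph_ll_self, ph_ps])
    obtain ⟨y', hy1, hy2⟩ := (C.sec 0).wit (C.sec_mem 0 hv) ⟨y', hy'⟩
    obtain ⟨y, hy3, rfl⟩ := C.sec_lift 0 hy1
    rw [sec_mulVec] at hy2
    obtain ⟨z, hz, hz2⟩ := C.sec_div 0 (Submodule.sub_mem _ hv (C.A_mem hy3)) (by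
      funext b
      have := congrFun hy2 b
      simp at this ⊢
      rw [this, sub_self])
    refine ⟨z, ?_⟩
    apply smul_cancel (ll_ne_zero (N := N) (0:k))
    rw [← Matrix.mulVec_smul, ← hz2, Matrix.mulVec_sub, C.AA, sub_zero, hv2]

end Cx
end BB

end

section
open MvPolynomial

namespace BB

set_option linter.unusedSectionVars false
variable {k : Type} [Field k] {N D : ℕ} {ι : Type} [Fintype ι]

lemma ll_mem_finite (P : Submodule k (MvPolynomial (Fin N) k)) (a : Fin N)
    (ha : (X a : MvPolynomial (Fin N) k) ∉ P) : {s : k | ll N s ∈ P}.Finite := by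
  classical
  obtain ⟨φ, h1, h2⟩ := P.exists_le_ker_of_notMem ha
  let f : Polynomial k := ∑ b : Fin N, Polynomial.monomial (b : ℕ) (φ (X b))
  have hf : f ≠ 0 := by
    intro h
    have := congrArg (fun g => Polynomial.coeff g (a : ℕ)) h
    simp only [f, Polynomial.finsetSum_coeff, Polynomial.coeff_monomial, Polynomial.coeff_zero] at this
    rw [Finset.sum_eq_single a] at this
    · simp at this; exact h1 this
    · intro b _ hb
      rw [if_neg]
      exact fun h => hb (Fin.ext h)
    · simp
  refine (f.roots.toFinset.finite_toSet).subset ?_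
  intro s hs
  simp only [Finset.mem_coe, Multiset.mem_toFinset, Polynomial.mem_roots hf, Polynomial.IsRoot]
  have h3 : φ (ll N s) = 0 := h2 hs
  simp only [f, Polynomial.eval_finset_sum, Polynomial.eval_monomial]
  rw [← h3, ll, map_sum]
  refine Finset.sum_congr rfl fun b _ => ?_
  rw [← smul_eq_C_mul, map_smul, smul_eq_mul, mul_comm]

lemma gen_lin (J : Ideal (MvPolynomial (Fin N) k)) :
    ∃ B : Set k, B.Finite ∧ ∀ s, s ∉ B → ∀ q, ll N s * q ∈ J → q ∉ J →
      ∃ f, f * q ∉ J ∧ ∀ a, X a * (f * q) ∈ J := by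
  let M := MvPolynomial (Fin N) k ⧸ J
  have hfin := associatedPrimes.finite (MvPolynomial (Fin N) k) M
  refine ⟨⋃ P ∈ {P ∈ associatedPrimes (MvPolynomial (Fin N) k) M | ∃ a, (X a : MvPolynomial (Fin N) k) ∉ P},
    {s : k | ll N s ∈ P}, ?_, ?_⟩
  · refine Set.Finite.biUnion (hfin.subset fun P h => h.1) ?_
    rintro P ⟨_, a, ha⟩
    exact ll_mem_finite (P.restrictScalars k) a ha
  · intro s hs q hq hqJ
    let u : M := Ideal.Quotient.mk J q
    have hu : u ≠ 0 := fun h => hqJ (Ideal.Quotient.eq_zero_iff_mem.1 h)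
    let U : Submodule (MvPolynomial (Fin N) k) M := Submodule.span _ {u}
    let u' : U := ⟨u, Submodule.mem_span_singleton_self u⟩
    have hu' : u' ≠ 0 := fun h => hu (congrArg Subtype.val h)
    obtain ⟨P, hP, hle⟩ := exists_le_isAssociatedPrime_of_isNoetherianRing (MvPolynomial (Fin N) k) u' hu'
    have hl : ll N s ∈ P := by
      apply hle
      rw [Submodule.mem_colon_singleton, Submodule.mem_bot]
      apply Subtype.ext
      exact Ideal.Quotient.eq_zero_iff_mem.2 hq
    have hP2 := hP.map_of_injective U.subtype U.injective_subtype
    have hX : ∀ a, (X a : MvPolynomial (Fin N) k) ∈ P := by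
      by_contra hcon
      push Not at hcon
      apply hs
      simp only [Set.mem_iUnion]
      exact ⟨P, ⟨hP2, hcon⟩, hl⟩
    obtain ⟨hpr, x, rfl⟩ := isAssociatedPrime_iff.1 hP
    obtain ⟨f, hf⟩ := Submodule.mem_span_singleton.1 x.2
    have hfe : (x : M) = Ideal.Quotient.mk J (f * q) := by rw [← hf]; rfl
    refine ⟨f, ?_, ?_⟩
    · intro h
      apply hpr.ne_top
      have hx0 : x = 0 := Subtype.ext (by rw [hfe]; exact Ideal.Quotient.eq_zero_iff_mem.2 h)
      rw [hx0]
      ext r; simp [Submodule.mem_colon_singleton]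
    · intro a
      have := hX a
      rw [Submodule.mem_colon_singleton, Submodule.mem_bot] at this
      have h2 := congrArg Subtype.val this
      rw [← Ideal.Quotient.eq_zero_iff_mem]
      rw [map_mul, ← hfe]
      exact h2

lemma comp_X_mul (a : Fin N) (f : MvPolynomial (Fin N) k) (e : ℕ) :
    homogeneousComponent (e+1) (X a * f) = X a * homogeneousComponent e f := by
  classical
  ext m
  rw [coeff_homogeneousComponent, coeff_X_mul', coeff_X_mul', coeff_homogeneousComponent]
  by_cases ha : a ∈ m.support
  · rw [if_pos ha, if_pos ha]
    have : m.degree = (m - Finsupp.single a 1).degree + 1 := by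
      have h1 : m = (m - Finsupp.single a 1) + Finsupp.single a 1 := by
        rw [tsub_add_cancel_of_le]
        rw [Finsupp.single_le_iff]
        have := Finsupp.mem_support_iff.1 ha
        omega
      conv_lhs => rw [h1]
      rw [map_add]; simp
    by_cases h : m.degree = e + 1
    · rw [if_pos h, if_pos (by omega)]
    · rw [if_neg h, if_neg (by omega)]
  · simp [ha]

namespace Cx

/-- rank one in homological degree 0 -/
def R1 (C : Cx k N D ι) (a0 : ι) : Prop := (∀ a, C.g a = 0 ↔ a = a0) ∧ C.deg a0 = 0

noncomputable def J (C : Cx k N D ι) (a0 : ι) : Ideal (MvPolynomial (Fin N) k) :=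
  LinearMap.range ((LinearMap.proj a0 : (ι → MvPolynomial (Fin N) k) →ₗ[MvPolynomial (Fin N) k] _) ∘ₗ C.A.mulVecLin)

lemma mem_J {C : Cx k N D ι} {a0 : ι} {f : MvPolynomial (Fin N) k} :
    f ∈ C.J a0 ↔ ∃ z, C.A.mulVec z a0 = f := by
  simp [J]

lemma pr_a0 {C : Cx k N D ι} {a0 : ι} (h : C.R1 a0) (e : ℕ) (w) :
    C.pr 0 e w a0 = homogeneousComponent e (w a0) := by
  unfold pr
  rw [if_pos ⟨(h.1 a0).2 rfl, by rw [h.2]; omega⟩, h.2, Nat.sub_zero]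

lemma J_comp {C : Cx k N D ι} {a0 : ι} (h : C.R1 a0) (e : ℕ) {f} (hf : f ∈ C.J a0) :
    homogeneousComponent e f ∈ C.J a0 := by
  obtain ⟨z, rfl⟩ := mem_J.1 hf
  rw [mem_J]
  exact ⟨C.pr 1 e z, by rw [C.A_pr, pr_a0 h]⟩

lemma bh0_eq {C : Cx k N D ι} {a0 : ι} (h : C.R1 a0) {e : ℕ} {v w} (hv : v ∈ C.bh 0 e)
    (hw : w ∈ C.bh 0 e) (hvw : v a0 = w a0) : v = w := by
  funext a
  by_cases ha : a = a0
  · rw [ha, hvw]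
  · have h1 : ∀ v ∈ C.bh 0 e, v a = 0 := by
      intro v hv
      ext m
      by_contra hm
      exact ha ((h.1 a).1 (hv a m (by simpa using hm)).1)
    rw [h1 v hv, h1 w hw]

lemma im_iff {C : Cx k N D ι} {a0 : ι} (h : C.R1 a0) {e : ℕ} {v} (hv : v ∈ C.bh 0 e) :
    (∃ z, C.A.mulVec z = v) ↔ v a0 ∈ C.J a0 := by
  rw [mem_J]
  constructor
  · rintro ⟨z, rfl⟩; exact ⟨z, rfl⟩
  · rintro ⟨z, hz⟩
    refine ⟨C.pr 1 e z, ?_⟩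
    rw [C.A_pr]
    refine bh0_eq h (C.pr_mem _ _ _) hv ?_
    rw [pr_a0 h, hz, ← pr_a0 h, C.pr_eq hv]

open Classical in
lemma single_mem {C : Cx k N D ι} {a0 : ι} (h : C.R1 a0) {e : ℕ} {f} (hf : f.IsHomogeneous e) :
    Pi.single a0 f ∈ C.bh 0 e := by
  intro a
  by_cases ha : a = a0
  · subst ha
    rw [Pi.single_eq_same, Hm_iff]
    exact Or.inr ⟨e, (h.1 a).2 rfl, by rw [h.2]; rfl, hf⟩
  · rw [Pi.single_eq_of_ne ha]; exact Hm_zero _ _ _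

lemma hom_of_mem {C : Cx k N D ι} {a0 : ι} (h : C.R1 a0) {e : ℕ} {v} (hv : v ∈ C.bh 0 e) :
    (v a0).IsHomogeneous e := by
  rcases (Hm_iff _ _ _ _).1 (hv a0) with h1 | ⟨q, _, h2, h3⟩
  · rw [h1]; exact isHomogeneous_zero _ _ _
  · rw [h.2] at h2
    obtain rfl : q = e := by omega
    exact h3

lemma J_soc {C : Cx k N D ι} {a0 : ι} (h : C.R1 a0) (hex : C.ex 0) {e : ℕ} (he : D < e) {f}
    (hf : f.IsHomogeneous e) (hX : ∀ a, X a * f ∈ C.J a0) : f ∈ C.J a0 := by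
  classical
  have := C.soc N 0 e hex (by omega) (Pi.single a0 f) (single_mem h hf) (by
    intro a
    refine (im_iff h (C.mul_mem (single_mem h hf) (isHomogeneous_X _ _))).2 ?_
    simpa using hX a)
  simpa using (im_iff h (single_mem h hf)).1 this

def good (C : Cx k N D ι) (a0 : ι) (s : k) : Prop :=
  ∀ e, D < e → ∀ q : MvPolynomial (Fin N) k, q.IsHomogeneous e → ll N s * q ∈ C.J a0 → q ∈ C.J a0

lemma good_fin {C : Cx k N D ι} {a0 : ι} (h : C.R1 a0) (hex : C.ex 0) :
    {s | ¬ C.good a0 s}.Finite := by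
  obtain ⟨B, hB, hB2⟩ := gen_lin (C.J a0)
  refine hB.subset ?_
  intro s hs
  by_contra hsB
  apply hs
  intro e he q hq hlq
  by_contra hqJ
  obtain ⟨f, hf1, hf2⟩ := hB2 s hsB q hlq hqJ
  obtain ⟨e', he'⟩ : ∃ e', homogeneousComponent e' (f * q) ∉ C.J a0 := by
    by_contra hcon
    push Not at hcon
    apply hf1
    rw [← sum_homogeneousComponent (f * q)]
    exact Ideal.sum_mem _ fun i _ => hcon i
  by_cases hee : D < e'
  · apply he'
    refine J_soc h hex hee (homogeneousComponent_isHomogeneous _ _) ?_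
    intro a
    rw [← comp_X_mul]
    exact J_comp h _ (hf2 a)
  · apply he'
    have : homogeneousComponent e' (f * q) = 0 := by
      classical
      ext m
      rw [coeff_homogeneousComponent]
      split_ifs with hm
      · rw [coeff_mul, coeff_zero]
        refine Finset.sum_eq_zero fun x hx => ?_
        rw [Finset.HasAntidiagonal.mem_antidiagonal] at hx
        have hd := congrArg Finsupp.degree hx
        rw [map_add] at hd
        rw [hq.coeff_eq_zero (by omega), mul_zero]
      · simp
    rw [this]; exact zero_mem _

lemma sec_R1 {C : Cx k (N+1) D ι} {a0 : ι} (h : C.R1 a0) (s : k) : (C.sec s).R1 a0 := h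

lemma sec_ex {C : Cx k (N+1) D ι} {a0 : ι} (h : C.R1 a0) (hex : C.ex 0) {s : k}
    (hs : C.good a0 s) : (C.sec s).ex 0 := by
  intro i hi e he v hv h0
  by_cases hi1 : 1 < i
  · exact C.ex_sec s hex i hi1 e he v hv h0
  · obtain rfl : i = 0 + 1 := by omega
    obtain ⟨e, rfl⟩ : ∃ e', e = e' + 1 := ⟨e - 1, by omega⟩
    refine C.step s 0 e ?_ ?_ v hv h0
    · intro w hw h1 _
      rw [im_iff h (C.mul_mem hw (ll_hom s))] at h1
      rw [im_iff h hw]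
      exact hs e (by omega) _ (hom_of_mem h hw) h1
    · intro w hw h1
      exact hex 1 (by omega) (e+1) (by omega) w hw h1

lemma sec_J {C : Cx k (N+1) D ι} {a0 : ι} (s : k) (f : MvPolynomial (Fin N) k) :
    f ∈ (C.sec s).J a0 ↔ ∃ g ∈ C.J a0, ph N s g = f := by
  constructor
  · intro hf
    obtain ⟨z, rfl⟩ := mem_J.1 hf
    refine ⟨C.A.mulVec (ps N s ∘ z) a0, mem_J.2 ⟨_, rfl⟩, ?_⟩
    have h1 : ph N s ∘ (ps N s ∘ z) = z := by funext a; simp [ph_ps]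
    conv_rhs => rw [← h1, sec_mulVec]
    rfl
  · rintro ⟨g, hg, rfl⟩
    obtain ⟨z, rfl⟩ := mem_J.1 hg
    rw [mem_J]
    exact ⟨ph N s ∘ z, by rw [sec_mulVec]; rfl⟩

end Cx
end BB

end

section
open MvPolynomial

namespace BB

set_option linter.unusedSectionVars false
variable {k : Type} [Field k] {N D : ℕ}

lemma rk_null {V V' : Type} [AddCommGroup V] [Module k V] [AddCommGroup V'] [Module k V']
    (f : V →ₗ[k] V') (W : Submodule k V) [FiniteDimensional k W] :
    Module.finrank k W = Module.finrank k (W.map f) + Module.finrank k (W ⊓ LinearMap.ker f : Submodule k V) := by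
  have h := LinearMap.finrank_range_add_finrank_ker (f.domRestrict W)
  have h1 : LinearMap.range (f.domRestrict W) = W.map f := by
    rw [LinearMap.domRestrict, LinearMap.range_comp, Submodule.range_subtype]
  have h2 : (LinearMap.ker (f.domRestrict W)).map W.subtype = W ⊓ LinearMap.ker f := by
    rw [LinearMap.domRestrict, LinearMap.ker_comp, Submodule.map_comap_subtype]
  rw [h1] at h
  rw [← h2, LinearEquiv.finrank_eq ((Submodule.equivMapOfInjective W.subtype W.injective_subtype _).symm)]
  exact h.symm

lemma finrank_map_inj {V V' : Type} [AddCommGroup V] [Module k V] [AddCommGroup V'] [Module k V']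
    (f : V →ₗ[k] V') (hf : Function.Injective f) (W : Submodule k V) :
    Module.finrank k (W.map f) = Module.finrank k W :=
  (LinearEquiv.finrank_eq (Submodule.equivMapOfInjective f hf W)).symm

instance fd_hom (e : ℕ) : FiniteDimensional k (homogeneousSubmodule (Fin N) k e) :=
  Module.Finite.iff_fg.2 (homogeneousSubmodule_fg _ _ _)

lemma fd_le {W : Submodule k (MvPolynomial (Fin N) k)} {e : ℕ} (h : W ≤ homogeneousSubmodule (Fin N) k e) :
    FiniteDimensional k W := Submodule.finiteDimensional_of_le h

noncomputable def Ls (N : ℕ) (s : k) : Submodule k (MvPolynomial (Fin N) k) :=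
  (Ideal.span {ll N s}).restrictScalars k

lemma mem_Ls {s : k} {f : MvPolynomial (Fin N) k} : f ∈ Ls N s ↔ ll N s ∣ f := by
  simp [Ls, Ideal.mem_span_singleton]

lemma Ls_ker (s : k) : Ls (N+1) s = LinearMap.ker (ph N s).toLinearMap := by
  ext f
  rw [mem_Ls, ll_dvd_iff]; rfl

/-- multiplication map -/
noncomputable def mu (f : MvPolynomial (Fin N) k) : MvPolynomial (Fin N) k →ₗ[k] MvPolynomial (Fin N) k :=
  LinearMap.mulLeft k f

lemma mu_apply (f g : MvPolynomial (Fin N) k) : mu f g = f * g := rfl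

lemma mu_inj {f : MvPolynomial (Fin N) k} (hf : f ≠ 0) : Function.Injective (mu f) :=
  fun _ _ h => mul_left_cancel₀ hf h

lemma avg : ∀ (c : ℕ) (T : Finset k) (_ : T.card = c) (N e : ℕ) (W : Submodule k (MvPolynomial (Fin N) k))
    (_ : W ≤ homogeneousSubmodule (Fin N) k e) (_ : T.card + 1 ≤ N + e),
    ∑ s ∈ T, Module.finrank k (W ⊓ Ls N s : Submodule k (MvPolynomial (Fin N) k)) ≤ e * Module.finrank k W := by
  classical
  intro c
  induction c with
  | zero => intro T hT; rw [Finset.card_eq_zero] at hT; subst hT; simp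
  | succ c ih =>
    intro T hT N e W hW hcard
    have hfd := fd_le hW
    have triv : T.card ≤ e → ∑ s ∈ T, Module.finrank k (W ⊓ Ls N s : Submodule k (MvPolynomial (Fin N) k)) ≤ e * Module.finrank k W := by
      intro hle
      calc _ ≤ ∑ s ∈ T, Module.finrank k W := Finset.sum_le_sum fun s _ => Submodule.finrank_mono inf_le_left
        _ = T.card * Module.finrank k W := by simp
        _ ≤ _ := Nat.mul_le_mul_right _ hle
    rcases N with _ | _ | N
    · exact triv (by omega)
    · exact triv (by omega)
    rcases e with _ | e
    · refine (Finset.sum_eq_zero fun s _ => ?_).le.trans (Nat.zero_le _)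
      rw [Submodule.finrank_eq_zero]
      rw [eq_bot_iff]
      rintro f ⟨h1, h2⟩
      exact hom_div0 (ll_hom s) (hW h1) (mem_Ls.1 h2)
    obtain ⟨t, T', ht, rfl, hT'⟩ := Finset.card_eq_succ.1 hT
    rw [Finset.sum_insert ht]
    rw [Finset.card_insert_of_notMem ht] at hcard
    set W1 : Submodule k (MvPolynomial (Fin (N+2)) k) :=
      W.comap (mu (ll (N+2) t)) ⊓ homogeneousSubmodule (Fin (N+2)) k e with hW1
    set W2 : Submodule k (MvPolynomial (Fin (N+1)) k) := W.map (ph (N+1) t).toLinearMap with hW2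
    have hW2h : W2 ≤ homogeneousSubmodule (Fin (N+1)) k (e+1) := by
      rintro _ ⟨f, hf, rfl⟩
      exact ph_hom t (hW hf)
    have fd1 : FiniteDimensional k W1 := fd_le inf_le_right
    have fd2 := fd_le hW2h
    have e1 : W ⊓ Ls (N+2) t = W1.map (mu (ll (N+2) t)) := by
      ext f
      constructor
      · rintro ⟨h1, h2⟩
        obtain ⟨q, hq, rfl⟩ := hom_div (ll_hom t) (hW h1) (mem_Ls.1 h2)
        exact ⟨q, ⟨h1, hq⟩, rfl⟩
      · rintro ⟨q, ⟨h1, h2⟩, rfl⟩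
        exact ⟨h1, mem_Ls.2 ⟨q, rfl⟩⟩
    have e2 : Module.finrank k (W ⊓ Ls (N+2) t : Submodule k _) = Module.finrank k W1 := by
      rw [e1, finrank_map_inj _ (mu_inj (ll_ne_zero t))]
    have e3 := rk_null (ph (N+1) t).toLinearMap W
    rw [← Ls_ker, e2, ← hW2] at e3
    have e4 : ∀ s ∈ T', Module.finrank k (W ⊓ Ls (N+2) s : Submodule k _) ≤
        Module.finrank k (W1 ⊓ Ls (N+2) s : Submodule k _) + Module.finrank k (W2 ⊓ Ls (N+1) s : Submodule k _) := by
      intro s hs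
      have hst : s ≠ t := fun h => ht (h ▸ hs)
      have fd3 : FiniteDimensional k (W ⊓ Ls (N+2) s : Submodule k _) := fd_le (inf_le_left.trans hW)
      have h := rk_null (ph (N+1) t).toLinearMap (W ⊓ Ls (N+2) s)
      rw [h, add_comm]
      refine Nat.add_le_add ?_ ?_
      · rw [← Ls_ker]
        have e5 : W ⊓ Ls (N+2) s ⊓ Ls (N+2) t = (W1 ⊓ Ls (N+2) s).map (mu (ll (N+2) t)) := by
          ext f
          constructor
          · rintro ⟨⟨h1, h2⟩, h3⟩
            obtain ⟨q, hq, rfl⟩ := hom_div (ll_hom t) (hW h1) (mem_Ls.1 h3)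
            refine ⟨q, ⟨⟨h1, hq⟩, ?_⟩, rfl⟩
            rw [SetLike.mem_coe, mem_Ls, ll_dvd_iff] at h2 ⊢
            rw [map_mul, ph_ll, mul_assoc] at h2
            have h5 : (C (t - s) : MvPolynomial (Fin (N+1)) k) ≠ 0 := by
              rw [Ne, C_eq_zero, sub_eq_zero]; exact fun h => hst h.symm
            exact (mul_eq_zero.1 ((mul_eq_zero.1 h2).resolve_left h5)).resolve_left (ll_ne_zero t)
          · rintro ⟨q, ⟨⟨h1, h2⟩, h3⟩, rfl⟩
            exact ⟨⟨h1, mem_Ls.2 (Dvd.dvd.mul_left (mem_Ls.1 h3) _)⟩, mem_Ls.2 ⟨q, rfl⟩⟩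
        rw [e5, finrank_map_inj _ (mu_inj (ll_ne_zero t))]
      · have fd4 : FiniteDimensional k (W2 ⊓ Ls (N+1) s : Submodule k _) := fd_le (inf_le_left.trans hW2h)
        refine Submodule.finrank_mono ?_
        rintro _ ⟨f, ⟨h1, h2⟩, rfl⟩
        refine ⟨⟨f, h1, rfl⟩, ?_⟩
        obtain ⟨q, rfl⟩ := mem_Ls.1 h2
        rw [SetLike.mem_coe, mem_Ls]
        show _ ∣ ph (N+1) t _
        rw [map_mul, ph_ll]
        exact Dvd.dvd.mul_right (Dvd.dvd.mul_left dvd_rfl _) _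
    have i1 := ih T' hT' (N+2) e W1 inf_le_right (by omega)
    have i2 := ih T' hT' (N+1) (e+1) W2 hW2h (by omega)
    have i3 := Finset.sum_le_sum e4
    rw [Finset.sum_add_distrib] at i3
    rw [e2, e3]
    nlinarith

/-- existence of a section with big image -/
lemma avg_ex (e : ℕ) (W : Submodule k (MvPolynomial (Fin (N+1)) k))
    (hW : W ≤ homogeneousSubmodule (Fin (N+1)) k e) (T : Finset k) (hT : T.card = N + e) (h0 : 0 < N + e) :
    ∃ s ∈ T, N * Module.finrank k W ≤ (N + e) * Module.finrank k (W.map (ph N s).toLinearMap) := by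
  have hfd := fd_le hW
  have h := avg _ T rfl (N+1) e W hW (by omega)
  by_contra hcon
  push Not at hcon
  have hne : T.Nonempty := Finset.card_pos.1 (by omega)
  have h2 := Finset.sum_lt_sum_of_nonempty hne hcon
  have h3 : ∑ s ∈ T, ((N+e) * Module.finrank k (W.map (ph N s).toLinearMap) +
      (N+e) * Module.finrank k (W ⊓ Ls (N+1) s : Submodule k _)) = ∑ s ∈ T, (N+e) * Module.finrank k W := by
    refine Finset.sum_congr rfl fun s _ => ?_
    rw [rk_null (ph N s).toLinearMap W, Ls_ker]; ring
  rw [Finset.sum_add_distrib, ← Finset.mul_sum T (fun s => Module.finrank k (W ⊓ Ls (N+1) s : Submodule k _))] at h3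
  simp only [Finset.sum_const, hT, smul_eq_mul] at h2 h3
  have h4 := Nat.mul_le_mul_left (N+e) h
  nlinarith

end BB

end

section
open MvPolynomial

namespace BB

set_option linter.unusedSectionVars false
variable {k : Type} [Field k] {N D : ℕ} {ι : Type} [Fintype ι]

lemma lin_mul_mem (J : Ideal (MvPolynomial (Fin N) k)) (q : MvPolynomial (Fin N) k)
    (h : ∀ a, X a * q ∈ J) (f : MvPolynomial (Fin N) k) (hf : f.IsHomogeneous 1) : f * q ∈ J := by
  have hf2 : f ∈ Submodule.span k (Set.range (X : Fin N → MvPolynomial (Fin N) k)) := by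
    rw [← homogeneousSubmodule_one_eq_span_X]; exact hf
  clear hf
  induction hf2 using Submodule.span_induction with
  | mem x hx => obtain ⟨a, rfl⟩ := hx; exact h a
  | zero => simp
  | add x y hx hy h1 h2 => rw [add_mul]; exact add_mem h1 h2
  | smul c x hx h1 => rw [smul_eq_C_mul, mul_assoc]; exact Ideal.mul_mem_left _ _ h1

lemma one_var (D : ℕ) : Module.finrank k (homogeneousSubmodule (Fin 1) k D) ≤ 1 := by
  refine finrank_le_one (⟨X 0 ^ D, ?_⟩ : homogeneousSubmodule (Fin 1) k D) ?_
  · have := (isHomogeneous_X k (0 : Fin 1)).pow D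
    simpa using this
  · rintro ⟨f, hf⟩
    refine ⟨coeff (Finsupp.single 0 D) f, ?_⟩
    apply Subtype.ext
    show coeff (Finsupp.single 0 D) f • X 0 ^ D = f
    ext m
    rw [coeff_smul, coeff_X_pow]
    by_cases h : Finsupp.single 0 D = m
    · rw [if_pos h, h]; simp
    · rw [if_neg h]
      have hf' : f.IsHomogeneous D := hf
      rw [smul_zero, hf'.coeff_eq_zero]
      intro h2
      apply h
      refine Finsupp.ext fun a => ?_
      have ha : a = 0 := Subsingleton.elim _ _
      subst ha
      rw [Finsupp.degree_eq_sum] at h2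
      simpa using h2.symm

namespace Cx

noncomputable def Je (C : Cx k N D ι) (a0 : ι) (e : ℕ) : Submodule k (MvPolynomial (Fin N) k) :=
  (C.J a0).restrictScalars k ⊓ homogeneousSubmodule (Fin N) k e

lemma mem_Je {C : Cx k N D ι} {a0 : ι} {e : ℕ} {f} :
    f ∈ C.Je a0 e ↔ f ∈ C.J a0 ∧ f.IsHomogeneous e := Iff.rfl

noncomputable def W (C : Cx k N D ι) (a0 : ι) : Submodule k (MvPolynomial (Fin N) k) where
  carrier := {q | q.IsHomogeneous D ∧ ∀ a, X a * q ∈ C.J a0}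
  zero_mem' := ⟨isHomogeneous_zero _ _ _, by simp⟩
  add_mem' := by
    rintro f g ⟨h1, h2⟩ ⟨h3, h4⟩
    exact ⟨h1.add h3, fun a => by rw [mul_add]; exact add_mem (h2 a) (h4 a)⟩
  smul_mem' := by
    rintro c f ⟨h1, h2⟩
    refine ⟨by rw [smul_eq_C_mul]; exact h1.C_mul _, fun a => ?_⟩
    rw [smul_eq_C_mul, mul_left_comm]
    exact Ideal.mul_mem_left _ _ (h2 a)

lemma mem_W {C : Cx k N D ι} {a0 : ι} {f} :
    f ∈ C.W a0 ↔ f.IsHomogeneous D ∧ ∀ a, X a * f ∈ C.J a0 := Iff.rfl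

lemma W_le (C : Cx k N D ι) (a0 : ι) : C.W a0 ≤ homogeneousSubmodule (Fin N) k D := fun _ h => h.1

lemma map_Je {C : Cx k (N+1) D ι} {a0 : ι} (h : C.R1 a0) (s : k) (e : ℕ) :
    (C.Je a0 e).map (ph N s).toLinearMap = (C.sec s).Je a0 e := by
  classical
  ext f
  constructor
  · rintro ⟨g, ⟨h1, h2⟩, rfl⟩
    exact ⟨(sec_J s _).2 ⟨g, h1, rfl⟩, ph_hom s h2⟩
  · rintro ⟨h1, h2⟩
    have hs := single_mem (sec_R1 h s) h2
    obtain ⟨z, hz, hz2⟩ := (C.sec s).wit hs ((im_iff (sec_R1 h s) hs).2 (by simpa using h1))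
    obtain ⟨y, hy, rfl⟩ := C.sec_lift s hz
    refine ⟨C.A.mulVec y a0, ⟨mem_J.2 ⟨y, rfl⟩, hom_of_mem h (C.A_mem hy)⟩, ?_⟩
    rw [sec_mulVec] at hz2
    have := congrFun hz2 a0
    simpa using this

lemma ker_Je {C : Cx k (N+1) D ι} {a0 : ι} {s : k} (hs : C.good a0 s) {e : ℕ} (he : D < e) :
    C.Je a0 (e+1) ⊓ Ls (N+1) s = (C.Je a0 e).map (mu (ll (N+1) s)) := by
  ext f
  constructor
  · rintro ⟨⟨h1, h2⟩, h3⟩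
    obtain ⟨q, hq, rfl⟩ := hom_div (ll_hom s) h2 (mem_Ls.1 h3)
    exact ⟨q, ⟨hs e he q hq h1, hq⟩, rfl⟩
  · rintro ⟨q, ⟨h1, h2⟩, rfl⟩
    refine ⟨⟨Ideal.mul_mem_left _ _ h1, ?_⟩, mem_Ls.2 ⟨q, rfl⟩⟩
    have := (ll_hom s).mul h2
    rwa [add_comm 1] at this

lemma ker_JW {C : Cx k (N+1) D ι} {a0 : ι} {s : k} (hs : C.good a0 s) :
    C.Je a0 (D+1) ⊓ Ls (N+1) s = (C.W a0).map (mu (ll (N+1) s)) := by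
  ext f
  constructor
  · rintro ⟨⟨h1, h2⟩, h3⟩
    obtain ⟨q, hq, rfl⟩ := hom_div (ll_hom s) h2 (mem_Ls.1 h3)
    refine ⟨q, ⟨hq, fun a => ?_⟩, rfl⟩
    refine hs (D+1) (by omega) _ ?_ ?_
    · have := (isHomogeneous_X k a).mul hq
      rwa [add_comm 1] at this
    · rw [mul_left_comm]; exact Ideal.mul_mem_left _ _ h1
  · rintro ⟨q, ⟨h1, h2⟩, rfl⟩
    refine ⟨⟨lin_mul_mem _ _ h2 _ (ll_hom s), ?_⟩, mem_Ls.2 ⟨q, rfl⟩⟩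
    have := (ll_hom s).mul h1
    rwa [add_comm 1] at this

instance (C : Cx k N D ι) (a0 : ι) (e : ℕ) : FiniteDimensional k (C.Je a0 e) := fd_le inf_le_right
instance (C : Cx k N D ι) (a0 : ι) : FiniteDimensional k (C.W a0) := fd_le (C.W_le a0)

noncomputable def PS (C : Cx k N D ι) (a0 : ι) : PowerSeries ℤ :=
  PowerSeries.mk fun m => (Module.finrank k (C.Je a0 (m + D + 1)) : ℤ)

lemma PS_sec {C : Cx k (N+1) D ι} {a0 : ι} (h : C.R1 a0) {s : k} (hs : C.good a0 s) :
    (1 - PowerSeries.X) * C.PS a0 = (C.sec s).PS a0 + PowerSeries.C (Module.finrank k (C.W a0) : ℤ) := by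
  ext m
  rw [sub_mul, one_mul, map_sub, map_add]
  have e1 := rk_null (ph N s).toLinearMap (C.Je a0 (m+D+1))
  rw [map_Je h, ← Ls_ker] at e1
  rcases m with _ | m
  · have e2 : 0 + D + 1 = D + 1 := by omega
    rw [e2, ker_JW hs, finrank_map_inj _ (mu_inj (ll_ne_zero s))] at e1
    simp only [PS, PowerSeries.coeff_mk, PowerSeries.coeff_zero_X_mul, PowerSeries.coeff_C]
    rw [e2, e1]
    simp
  · rw [show m + 1 + D + 1 = (m + D + 1) + 1 by ring, ker_Je hs (by omega), finrank_map_inj _ (mu_inj (ll_ne_zero s))] at e1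
    simp only [PS, PowerSeries.coeff_mk, PowerSeries.coeff_succ_X_mul, PowerSeries.coeff_C]
    rw [show m + 1 + D + 1 = (m + D + 1) + 1 by ring, e1]
    simp

lemma W_sec {C : Cx k (N+1) D ι} {a0 : ι} (s : k) :
    (C.W a0).map (ph N s).toLinearMap ≤ (C.sec s).W a0 := by
  rintro _ ⟨q, ⟨h1, h2⟩, rfl⟩
  refine ⟨ph_hom s h1, fun a => ?_⟩
  rw [sec_J]
  refine ⟨ps N s (X a) * q, lin_mul_mem _ _ h2 _ (ps_hom s (isHomogeneous_X _ _)), ?_⟩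
  rw [map_mul, ph_ps]; rfl

lemma pick [Infinite k] {C : Cx k (N+1) D ι} {a0 : ι} (h : C.R1 a0) (hex : C.ex 0) :
    ∃ s, C.good a0 s ∧ N * Module.finrank k (C.W a0) ≤
      (N + D) * Module.finrank k ((C.W a0).map (ph N s).toLinearMap) := by
  have hinf : {s | C.good a0 s}.Infinite := by
    have := (good_fin h hex).infinite_compl
    refine this.mono ?_
    intro s hs
    simpa using hs
  by_cases h0 : 0 < N + D
  · obtain ⟨T, hT, hT2⟩ := hinf.exists_subset_card_eq (N + D)
    obtain ⟨s, hs, hs2⟩ := avg_ex D (C.W a0) (C.W_le a0) T hT2 h0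
    exact ⟨s, hT hs, hs2⟩
  · obtain ⟨s, hs⟩ := hinf.nonempty
    refine ⟨s, hs, ?_⟩
    obtain rfl : N = 0 := by omega
    simp

theorem main [Infinite k] : ∀ (N : ℕ) (C : Cx k N D ι) (a0 : ι) (_ : C.R1 a0) (_ : C.ex 0),
    ∃ b : ℕ → ℕ, C.PS a0 * (1 - PowerSeries.X) ^ N =
        ∑ j ∈ Finset.range N, PowerSeries.C (b j : ℤ) * (1 - PowerSeries.X) ^ j ∧
      (∀ j, j + 1 < N → (j + 1) * b (j + 1) ≤ (D + 1 + j) * b j) ∧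
      (∀ j, j + 1 = N → b j = Module.finrank k (C.W a0)) ∧
      (0 < N → b 0 ≤ 1) := by
  intro N
  induction N with
  | zero =>
    intro C a0 h hex
    refine ⟨0, ?_, by simp, by simp, by simp⟩
    simp only [pow_zero, mul_one, Finset.range_zero, Finset.sum_empty]
    ext m
    simp only [PS, PowerSeries.coeff_mk, map_zero]
    rw [Nat.cast_eq_zero, Submodule.finrank_eq_zero, eq_bot_iff]
    rintro f ⟨_, hf⟩
    have hf' : f.IsHomogeneous (m + D + 1) := hf
    show f = 0
    ext u
    rw [hf'.coeff_eq_zero, coeff_zero]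
    have : u = 0 := Subsingleton.elim _ _
    rw [this]; simp
  | succ N ih =>
    intro C a0 h hex
    obtain ⟨s, hs, hs2⟩ := pick h hex
    obtain ⟨b, hb1, hb2, hb3, hb4⟩ := ih (C.sec s) a0 (sec_R1 h s) (sec_ex h hex hs)
    refine ⟨fun j => if j = N then Module.finrank k (C.W a0) else b j, ?_, ?_, ?_, ?_⟩
    · have e1 : C.PS a0 * (1 - PowerSeries.X) ^ (N+1) = ((1 - PowerSeries.X) * C.PS a0) * (1 - PowerSeries.X)^N := by ring
      rw [e1, PS_sec h hs, add_mul, hb1, Finset.sum_range_succ]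
      congr 1
      · refine Finset.sum_congr rfl fun j hj => ?_
        rw [Finset.mem_range] at hj
        simp only [if_neg (show j ≠ N by omega)]
      · simp
    · intro j hj
      by_cases hjN : j + 1 = N
      · simp only [if_pos hjN, if_neg (show j ≠ N by omega)]
        rw [hb3 j hjN]
        have h5 := Submodule.finrank_mono (W_sec (C := C) (a0 := a0) s)
        subst hjN
        calc _ ≤ (j + 1 + D) * Module.finrank k ((C.W a0).map (ph (j+1) s).toLinearMap) := hs2
          _ ≤ _ := by rw [show j + 1 + D = D + 1 + j by ring]; exact Nat.mul_le_mul_left _ h5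
      · simp only [if_neg hjN, if_neg (show j ≠ N by omega)]
        exact hb2 j (by omega)
    · intro j hj
      simp [show j = N by omega]
    · intro _
      by_cases h0 : 0 = N
      · subst h0
        simp only [if_true]
        exact (Submodule.finrank_mono (C.W_le a0)).trans (one_var D)
      · simp only [if_neg h0]
        exact hb4 (by omega)

end Cx
end BB

end

section
open MvPolynomial

namespace BB

set_option linter.unusedSectionVars false
variable {k : Type} [Field k] {N D : ℕ} {ι : Type} [Fintype ι]

noncomputable def hh (k : Type) [Field k] (N e : ℕ) : ℕ := Module.finrank k (homogeneousSubmodule (Fin N) k e)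

noncomputable def HS (k : Type) [Field k] (N : ℕ) : PowerSeries ℤ := PowerSeries.mk fun m => (hh k N m : ℤ)

lemma map_hom (s : k) (e : ℕ) : (homogeneousSubmodule (Fin (N+1)) k e).map (ph N s).toLinearMap =
    homogeneousSubmodule (Fin N) k e := by
  ext f
  constructor
  · rintro ⟨g, hg, rfl⟩; exact ph_hom s hg
  · intro hf; exact ⟨ps N s f, ps_hom s hf, ph_ps s f⟩

lemma ker_hom (s : k) (e : ℕ) : homogeneousSubmodule (Fin (N+1)) k (e+1) ⊓ Ls (N+1) s =
    (homogeneousSubmodule (Fin (N+1)) k e).map (mu (ll (N+1) s)) := by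
  ext f
  constructor
  · rintro ⟨h2, h3⟩
    obtain ⟨q, hq, rfl⟩ := hom_div (ll_hom s) h2 (mem_Ls.1 h3)
    exact ⟨q, hq, rfl⟩
  · rintro ⟨q, h2, rfl⟩
    refine ⟨?_, mem_Ls.2 ⟨q, rfl⟩⟩
    have := (ll_hom s).mul h2
    rwa [add_comm 1] at this

lemma ker_hom0 (s : k) : homogeneousSubmodule (Fin (N+1)) k 0 ⊓ Ls (N+1) s = ⊥ := by
  rw [eq_bot_iff]
  rintro f ⟨h2, h3⟩
  exact hom_div0 (ll_hom s) h2 (mem_Ls.1 h3)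

lemma HS_succ (N : ℕ) : (1 - PowerSeries.X) * HS k (N+1) = HS k N := by
  ext m
  rw [sub_mul, one_mul, map_sub]
  have e1 := rk_null (ph N (0:k)).toLinearMap (homogeneousSubmodule (Fin (N+1)) k m)
  rw [map_hom, ← Ls_ker] at e1
  rcases m with _ | m
  · rw [ker_hom0, finrank_bot] at e1
    simp only [HS, PowerSeries.coeff_mk, PowerSeries.coeff_zero_X_mul, hh]
    rw [e1]; simp
  · rw [ker_hom, finrank_map_inj _ (mu_inj (ll_ne_zero 0))] at e1
    simp only [HS, PowerSeries.coeff_mk, PowerSeries.coeff_succ_X_mul, hh]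
    rw [e1]; simp

lemma HS_zero : HS k 0 = 1 := by
  ext m
  simp only [HS, PowerSeries.coeff_mk, PowerSeries.coeff_one, hh]
  split_ifs with h
  · subst h
    rw [homogeneousSubmodule_zero]
    rw [Nat.cast_eq_one]
    have : (1 : Submodule k (MvPolynomial (Fin 0) k)) = Submodule.span k {1} := Submodule.one_eq_span
    rw [this, finrank_span_singleton one_ne_zero]
  · rw [Nat.cast_eq_zero, Submodule.finrank_eq_zero, eq_bot_iff]
    intro f hf
    have hf' : f.IsHomogeneous m := hf
    show f = 0
    ext u
    rw [hf'.coeff_eq_zero, coeff_zero]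
    have : u = 0 := Subsingleton.elim _ _
    rw [this]; simp; omega

lemma HS_eq (N : ℕ) : HS k N * (1 - PowerSeries.X) ^ N = 1 := by
  induction N with
  | zero => simp [HS_zero]
  | succ N ih => rw [pow_succ', ← mul_assoc, mul_comm (HS k (N+1)), HS_succ, ih]

namespace Cx

open Classical in
noncomputable def bet (C : Cx k N D ι) (i : ℕ) : ℕ := (Finset.univ.filter fun a => C.g a = i).card

def exF (C : Cx k N D ι) : Prop :=
  ∀ i, 0 < i → ∀ e, ∀ v ∈ C.bh i e, C.A.mulVec v = 0 → ∃ w, C.A.mulVec w = v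

def lin (C : Cx k N D ι) : Prop := ∀ a, 0 < C.g a → C.deg a = D + C.g a

lemma exF.ex {C : Cx k N D ι} (h : C.exF) : C.ex 0 := fun i hi e _ => h i hi e

open Classical in
noncomputable def Ua (C : Cx k N D ι) (i e : ℕ) (a : ι) : Submodule k (MvPolynomial (Fin N) k) :=
  if C.g a = i ∧ C.deg a ≤ e then homogeneousSubmodule (Fin N) k (e - C.deg a) else ⊥

lemma Ua_iff (C : Cx k N D ι) (i e : ℕ) (a : ι) (f) : f ∈ C.Ua i e a ↔ Hm f (C.g a = i) (C.deg a) e := by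
  rw [Hm_iff]
  unfold Ua
  split_ifs with h
  · constructor
    · intro hf; exact Or.inr ⟨e - C.deg a, h.1, by omega, hf⟩
    · rintro (rfl | ⟨q, h1, h2, h3⟩)
      · exact zero_mem _
      · rw [show e - C.deg a = q by omega]; exact h3
  · rw [Submodule.mem_bot]
    constructor
    · exact Or.inl
    · rintro (rfl | ⟨q, h1, h2, h3⟩)
      · rfl
      · exact absurd ⟨h1, by omega⟩ h

noncomputable def bhE (C : Cx k N D ι) (i e : ℕ) : C.bh i e ≃ₗ[k] (∀ a, C.Ua i e a) where
  toFun v := fun a => ⟨v.1 a, (C.Ua_iff i e a _).2 (v.2 a)⟩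
  map_add' _ _ := rfl
  map_smul' _ _ := rfl
  invFun u := ⟨fun a => (u a).1, fun a => (C.Ua_iff i e a _).1 (u a).2⟩
  left_inv _ := rfl
  right_inv _ := rfl

instance (C : Cx k N D ι) (i e : ℕ) (a : ι) : FiniteDimensional k (C.Ua i e a) := by
  by_cases h : C.g a = i ∧ C.deg a ≤ e
  · have : C.Ua i e a = homogeneousSubmodule (Fin N) k (e - C.deg a) := if_pos h
    rw [this]; infer_instance
  · have : C.Ua i e a = ⊥ := if_neg h
    rw [this]; infer_instance

instance (C : Cx k N D ι) (i e : ℕ) : FiniteDimensional k (C.bh i e) :=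
  Module.Finite.equiv (C.bhE i e).symm

lemma finrank_bh {C : Cx k N D ι} (hl : C.lin) (i e : ℕ) :
    Module.finrank k (C.bh (i+1) e) = C.bet (i+1) * (if D + i + 1 ≤ e then hh k N (e - (D + i + 1)) else 0) := by
  classical
  rw [LinearEquiv.finrank_eq (C.bhE (i+1) e), Module.finrank_pi_fintype, bet, Finset.card_eq_sum_ones, Finset.sum_mul,
    Finset.sum_filter]
  refine Finset.sum_congr rfl fun a _ => ?_
  unfold Ua
  by_cases ha : C.g a = i + 1
  · have := hl a (by omega)
    rw [if_pos ha, one_mul]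
    by_cases h2 : D + i + 1 ≤ e
    · rw [if_pos h2, if_pos ⟨ha, by omega⟩, this, ha]; rfl
    · rw [if_neg h2, if_neg (fun h => h2 (by have := h.2; omega)), finrank_bot]
  · rw [if_neg ha, if_neg (fun h => ha h.1), finrank_bot]

noncomputable def Al (C : Cx k N D ι) : (ι → MvPolynomial (Fin N) k) →ₗ[k] (ι → MvPolynomial (Fin N) k) :=
  C.A.mulVecLin.restrictScalars k

lemma Al_apply (C : Cx k N D ι) (v) : C.Al v = C.A.mulVec v := rfl

noncomputable def ZS (C : Cx k N D ι) (i : ℕ) : PowerSeries ℤ :=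
  PowerSeries.mk fun m => (Module.finrank k ((C.bh (i+1) (m+D+1)).map C.Al) : ℤ)

lemma ES {C : Cx k N D ι} (hl : C.lin) (hex : C.exF) (i : ℕ) :
    PowerSeries.C (C.bet (i+1) : ℤ) * PowerSeries.X ^ i * HS k N = C.ZS i + C.ZS (i+1) := by
  ext m
  rw [mul_assoc, PowerSeries.coeff_C_mul, PowerSeries.coeff_X_pow_mul', map_add]
  simp only [ZS, HS, PowerSeries.coeff_mk]
  have h := rk_null C.Al (C.bh (i+1) (m+D+1))
  have h2 : C.bh (i+1) (m+D+1) ⊓ LinearMap.ker C.Al = (C.bh (i+1+1) (m+D+1)).map C.Al := by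
    ext v
    constructor
    · rintro ⟨h1, h3⟩
      obtain ⟨w, hw, hw2⟩ := C.wit h1 (hex (i+1) (by omega) _ v h1 h3)
      exact ⟨w, hw, hw2⟩
    · rintro ⟨w, hw, rfl⟩
      exact ⟨C.A_mem hw, C.AA w⟩
  rw [h2, finrank_bh hl] at h
  rw [← Nat.cast_add, ← h]
  by_cases hi : i ≤ m
  · rw [if_pos hi, if_pos (by omega), show m + D + 1 - (D + i + 1) = m - i by omega]; simp
  · rw [if_neg hi, if_neg (by omega)]; simp

lemma ZS_zero {C : Cx k N D ι} {a0 : ι} (h : C.R1 a0) : C.ZS 0 = C.PS a0 := by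
  classical
  ext m
  simp only [ZS, PS, PowerSeries.coeff_mk, Nat.cast_inj]
  have : ((C.bh (0+1) (m+D+1)).map C.Al).map ((LinearMap.proj a0 : (ι → MvPolynomial (Fin N) k) →ₗ[k] _)) = C.Je a0 (m+D+1) := by
    ext f
    constructor
    · rintro ⟨_, ⟨z, hz, rfl⟩, rfl⟩
      exact ⟨mem_J.2 ⟨z, rfl⟩, hom_of_mem h (C.A_mem hz)⟩
    · rintro ⟨h1, h2⟩
      have hs := single_mem h h2
      obtain ⟨z, hz, hz2⟩ := C.wit hs ((im_iff h hs).2 (by simpa using h1))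
      exact ⟨_, ⟨z, hz, rfl⟩, by rw [Al_apply, hz2]; simp⟩
  rw [← this]
  have h2 := rk_null ((LinearMap.proj a0 : (ι → MvPolynomial (Fin N) k) →ₗ[k] _)) ((C.bh (0+1) (m+D+1)).map C.Al)
  have h3 : (C.bh (0+1) (m+D+1)).map C.Al ⊓ LinearMap.ker ((LinearMap.proj a0 : (ι → MvPolynomial (Fin N) k) →ₗ[k] _)) = ⊥ := by
    rw [eq_bot_iff]
    rintro _ ⟨⟨z, hz, rfl⟩, h4⟩
    exact bh0_eq h (C.A_mem hz) (zero_mem _) h4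
  rw [h3, finrank_bot] at h2
  rw [h2, add_zero]

lemma ZS_last {C : Cx k N D ι} {L : ℕ} (hL : ∀ a, C.g a ≤ L) : C.ZS L = 0 := by
  ext m
  simp only [ZS, PowerSeries.coeff_mk, map_zero, Nat.cast_eq_zero]
  have : C.bh (L+1) (m+D+1) = ⊥ := by
    rw [eq_bot_iff]
    intro v hv
    show v = 0
    funext a
    ext u
    by_contra hu
    have := (hv a u (by simpa using hu)).1
    have := hL a
    omega
  rw [this, Submodule.map_bot, finrank_bot]

theorem hilb {C : Cx k N D ι} {a0 : ι} (h : C.R1 a0) (hl : C.lin) (hex : C.exF) {L : ℕ} (hL : ∀ a, C.g a ≤ L) :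
    C.PS a0 * (1 - PowerSeries.X) ^ N =
      ∑ i ∈ Finset.range L, PowerSeries.C ((-1)^i * C.bet (i+1) : ℤ) * PowerSeries.X ^ i := by
  have key : ∀ m, C.PS a0 = ∑ i ∈ Finset.range m, PowerSeries.C ((-1)^i * C.bet (i+1) : ℤ) * PowerSeries.X ^ i * HS k N
      + (-1)^m * C.ZS m := by
    intro m
    induction m with
    | zero => simp [ZS_zero h]
    | succ m ih =>
      rw [ih, Finset.sum_range_succ]
      have := ES hl hex m
      simp only [map_mul, map_pow, map_neg, map_one] at this ⊢
      linear_combination -(-1)^m * this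
  rw [key L, ZS_last hL, mul_zero, add_zero, Finset.sum_mul]
  refine Finset.sum_congr rfl fun i _ => ?_
  rw [mul_assoc, HS_eq, mul_one]

end Cx

lemma coeff_one_sub (j t : ℕ) : PowerSeries.coeff t ((1 - PowerSeries.X : PowerSeries ℤ) ^ j) = (-1)^t * (j.choose t : ℤ) := by
  induction j generalizing t with
  | zero =>
    rcases t with _ | t
    · simp
    · simp [PowerSeries.coeff_one]
  | succ j ih =>
    rw [pow_succ', sub_mul, one_mul, map_sub]
    rcases t with _ | t
    · simp [ih]
    · rw [PowerSeries.coeff_succ_X_mul, ih, ih, Nat.choose_succ_succ, pow_succ]; push_cast; ring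

lemma extract {N L : ℕ} (b B : ℕ → ℕ) (hB : ∀ i, L ≤ i → B i = 0)
    (h : ∑ j ∈ Finset.range N, PowerSeries.C (b j : ℤ) * (1 - PowerSeries.X) ^ j =
      ∑ i ∈ Finset.range L, PowerSeries.C ((-1)^i * B i : ℤ) * PowerSeries.X ^ i) (t : ℕ) :
    B t = ∑ j ∈ Finset.range N, b j * j.choose t := by
  have h1 := congrArg (PowerSeries.coeff t) h
  simp only [map_sum, PowerSeries.coeff_C_mul, coeff_one_sub, PowerSeries.coeff_X_pow] at h1
  have h2 : ∑ x ∈ Finset.range L, (-1 : ℤ)^x * B x * (if t = x then 1 else 0) = (-1)^t * B t := by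
    by_cases ht : t < L
    · rw [Finset.sum_eq_single t]
      · simp
      · intro i _ hi; rw [if_neg (Ne.symm hi), mul_zero]
      · intro h; exact absurd (Finset.mem_range.2 ht) h
    · rw [hB t (by omega)]
      simp only [Nat.cast_zero, mul_zero]
      refine Finset.sum_eq_zero fun i hi => ?_
      rw [Finset.mem_range] at hi
      rw [if_neg (by omega), mul_zero]
  rw [h2] at h1
  have h3 : (-1 : ℤ)^t * (∑ j ∈ Finset.range N, (b j * j.choose t : ℤ)) = (-1)^t * B t := by
    rw [← h1, Finset.mul_sum]
    refine Finset.sum_congr rfl fun j _ => by ring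
  have h4 : (-1 : ℤ)^t ≠ 0 := by simp
  have := mul_left_cancel₀ h4 h3
  exact_mod_cast this.symm

end BB

end

section
open MvPolynomial

namespace BB

set_option linter.unusedSectionVars false
variable {k K : Type} [Field k] [Field K] [Algebra k K] {N D : ℕ} {ι : Type} [Fintype ι]

/-- apply a linear functional coefficientwise -/
noncomputable def cf (φ : K →ₗ[k] k) (f : MvPolynomial (Fin N) K) : MvPolynomial (Fin N) k :=
  ∑ m ∈ f.support, monomial m (φ (coeff m f))

lemma coeff_cf (φ : K →ₗ[k] k) (f : MvPolynomial (Fin N) K) (m) : coeff m (cf φ f) = φ (coeff m f) := by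
  classical
  simp only [cf, coeff_sum, coeff_monomial]
  rw [Finset.sum_ite_eq']
  split_ifs with h
  · rfl
  · rw [MvPolynomial.notMem_support_iff.1 h, map_zero]

lemma cf_mul (φ : K →ₗ[k] k) (f : MvPolynomial (Fin N) k) (g : MvPolynomial (Fin N) K) :
    cf φ (map (algebraMap k K) f * g) = f * cf φ g := by
  classical
  ext m
  rw [coeff_cf, coeff_mul, coeff_mul, map_sum]
  refine Finset.sum_congr rfl fun x _ => ?_
  rw [coeff_map, coeff_cf, ← Algebra.smul_def, map_smul, smul_eq_mul]

lemma cf_sum (φ : K →ₗ[k] k) {α : Type} (s : Finset α) (f : α → MvPolynomial (Fin N) K) :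
    cf φ (∑ a ∈ s, f a) = ∑ a ∈ s, cf φ (f a) := by
  ext m
  simp [coeff_cf, coeff_sum]

namespace Cx

lemma map_mulVec' (C : Cx k N D ι) (v : ι → MvPolynomial (Fin N) k) :
    (C.A.map (map (algebraMap k K))).mulVec (fun a => map (algebraMap k K) (v a)) =
      fun a => map (algebraMap k K) (C.A.mulVec v a) := by
  funext a
  simp [Matrix.mulVec, dotProduct]

lemma cf_mulVec (C : Cx k N D ι) (φ : K →ₗ[k] k) (v : ι → MvPolynomial (Fin N) K) :
    C.A.mulVec (fun a => cf φ (v a)) = fun a => cf φ ((C.A.map (map (algebraMap k K))).mulVec v a) := by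
  funext a
  simp [Matrix.mulVec, dotProduct, cf_sum, cf_mul]

variable (K) in
noncomputable def bc (C : Cx k N D ι) : Cx K N D ι where
  g := C.g
  deg := C.deg
  A := C.A.map (map (algebraMap k K))
  hom := by
    intro a b m hm
    refine C.hom a b m ?_
    intro h
    apply hm
    rw [Matrix.map_apply, coeff_map, h, map_zero]
  sq := by
    rw [← Matrix.map_mul, C.sq]
    ext; simp
  deg_le := C.deg_le

lemma bc_exF {C : Cx k N D ι} (h : C.exF) : (C.bc K).exF := by
  classical
  intro i hi e v hv h0
  let B := Module.Basis.ofVectorSpace k K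
  let F := Finset.univ.biUnion fun a : ι => (v a).support.biUnion fun m => (B.repr (coeff m (v a))).support
  have hw : ∀ β, ∃ w, C.A.mulVec w = fun a => cf (B.coord β) (v a) := by
    intro β
    refine h i hi e _ ?_ ?_
    · intro a m hm
      refine hv a m ?_
      intro h1
      apply hm
      rw [coeff_cf, h1, map_zero]
    · rw [cf_mulVec]
      have : (C.A.map (map (algebraMap k K))).mulVec v = 0 := h0
      rw [this]
      funext a
      ext m
      simp [coeff_cf]
  choose w hw using hw
  refine ⟨∑ β ∈ F, (MvPolynomial.C (B β) : MvPolynomial (Fin N) K) • fun a => map (algebraMap k K) (w β a), ?_⟩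
  rw [Matrix.mulVec_sum]
  have e1 : ∀ β, (C.bc K).A.mulVec ((MvPolynomial.C (B β) : MvPolynomial (Fin N) K) • fun a => map (algebraMap k K) (w β a)) =
      fun a => MvPolynomial.C (B β) * map (algebraMap k K) (cf (B.coord β) (v a)) := by
    intro β
    rw [Matrix.mulVec_smul]
    show _ • (C.A.map (map (algebraMap k K))).mulVec _ = _
    rw [map_mulVec', hw]
    rfl
  rw [Finset.sum_congr rfl fun β _ => e1 β]
  funext a
  ext m
  rw [Finset.sum_apply, coeff_sum]
  simp only [coeff_C_mul, coeff_map, coeff_cf]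
  by_cases hm : coeff m (v a) = 0
  · simp [hm]
  · have hsub : (B.repr (coeff m (v a))).support ⊆ F := by
      intro β hβ
      simp only [F, Finset.mem_biUnion]
      exact ⟨a, Finset.mem_univ _, m, MvPolynomial.mem_support_iff.2 hm, hβ⟩
    have h5 := B.linearCombination_repr (coeff m (v a))
    rw [Finsupp.linearCombination_apply, Finsupp.sum_of_support_subset _ hsub _ (by simp)] at h5
    rw [← h5]
    refine Finset.sum_congr rfl fun β _ => ?_
    rw [h5, Algebra.smul_def, mul_comm, Module.Basis.coord_apply]

/-- The main numerical structure. -/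
theorem numeric {C : Cx k N D ι} {a0 : ι} (h : C.R1 a0) (hl : C.lin) (hex : C.exF) :
    ∃ b : ℕ → ℕ, C.PS a0 * (1 - PowerSeries.X) ^ N =
        ∑ j ∈ Finset.range N, PowerSeries.C (b j : ℤ) * (1 - PowerSeries.X) ^ j ∧
      (∀ t, C.bet (t+1) = ∑ j ∈ Finset.range N, b j * j.choose t) ∧
      (∀ j, j + 1 < N → (j + 1) * b (j + 1) ≤ (D + 1 + j) * b j) ∧
      (0 < N → b 0 ≤ 1) := by
  classical
  let K := AlgebraicClosure k
  let C' := C.bc K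
  have h' : C'.R1 a0 := h
  have hl' : C'.lin := hl
  have hex' : C'.exF := bc_exF hex
  obtain ⟨b, hb1, hb2, _, hb4⟩ := C'.main N a0 h' hex'.ex
  obtain ⟨L, hL⟩ : ∃ L, ∀ a, C.g a ≤ L := ⟨Finset.univ.sup C.g, fun a => Finset.le_sup (Finset.mem_univ a)⟩
  have e1 := hilb h hl hex hL
  have e2 := hilb h' hl' hex' (L := L) hL
  have e3 : ∀ i, C'.bet i = C.bet i := fun _ => rfl
  simp only [e3] at e2
  refine ⟨b, by rw [e1, ← e2, hb1], ?_, hb2, hb4⟩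
  rw [e2] at hb1
  refine extract b (fun t => C.bet (t+1)) ?_ hb1.symm
  intro i hi
  unfold bet
  rw [Finset.card_eq_zero, Finset.filter_eq_empty_iff]
  intro a _
  have := hL a
  omega

end Cx
end BB

end

section
open MvPolynomial

namespace BB

set_option linter.unusedSectionVars false
variable {k : Type} [Field k] {N D : ℕ} {ι : Type} [Fintype ι]

lemma dim_le_of_inj {A B : Type} [CommRing A] [CommRing B] [Algebra A B] [Algebra.IsIntegral A B]
    [FaithfulSMul A B] : ringKrullDim A ≤ ringKrullDim B := by
  unfold ringKrullDim
  rw [Order.krullDim]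
  apply iSup_le
  intro l
  have hP : Nonempty (Ideal.primesOver l.head.asIdeal B) := inferInstance
  obtain ⟨P, hP1, hP2⟩ := hP
  obtain ⟨L, hL, -⟩ := Ideal.exists_ltSeries_of_hasGoingUp l P
  rw [← hL]
  exact Order.LTSeries.length_le_krullDim L

lemma dim_le_of_fin {A B : Type} [CommRing A] [CommRing B] (f : A →+* B) (hf : f.Finite)
    (hi : Function.Injective f) : ringKrullDim A ≤ ringKrullDim B := by
  letI := f.toAlgebra
  have h1 : Module.Finite A B := hf
  have h2 : FaithfulSMul A B := (faithfulSMul_iff_algebraMap_injective _ _).2 hi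
  exact dim_le_of_inj

lemma noeth (I : Ideal (MvPolynomial (Fin N) k)) (hI : I ≠ ⊤) :
    ∃ s : ℕ, (s : WithBot ℕ∞) ≤ ringKrullDim (MvPolynomial (Fin N) k ⧸ I) ∧
      ∃ g : MvPolynomial (Fin s) k →ₐ[k] (MvPolynomial (Fin N) k ⧸ I), g.Finite := by
  have : Nontrivial (MvPolynomial (Fin N) k ⧸ I) := Ideal.Quotient.nontrivial_iff.mpr hI
  obtain ⟨s, g, hg, hf⟩ := exists_finite_inj_algHom_of_fg k (MvPolynomial (Fin N) k ⧸ I)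
  refine ⟨s, ?_, g, hf⟩
  have := dim_le_of_fin g.toRingHom hf hg
  rw [MvPolynomial.ringKrullDim_of_isNoetherianRing] at this
  simpa using this

lemma dim_quot_le (I : Ideal (MvPolynomial (Fin N) k)) {c : ℕ} 
    (hI : ∀ P : PrimeSpectrum (MvPolynomial (Fin N) k), I ≤ P.asIdeal → (c : ℕ∞) ≤ Order.height P) {s : ℕ}
    (hs : (s : WithBot ℕ∞) ≤ ringKrullDim (MvPolynomial (Fin N) k ⧸ I)) : s + c ≤ N := by
  rw [ringKrullDim_quotient] at hs
  rw [Order.le_krullDim_iff] at hs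
  obtain ⟨l, hl⟩ := hs
  have hh := hI l.head.1 l.head.2
  have h1 := Order.length_le_coheight_head (p := l.map Subtype.val (fun _ _ ↦ id))
  have h2 : (((Order.height l.head.1 + Order.coheight l.head.1 : ℕ∞)) : WithBot ℕ∞) ≤ ringKrullDim (MvPolynomial (Fin N) k) := by
    unfold ringKrullDim
    rw [Order.krullDim_eq_iSup_height_add_coheight_of_nonempty]
    exact WithBot.coe_le_coe.2 (le_iSup (fun a => Order.height a + Order.coheight a) l.head.1)
  rw [MvPolynomial.ringKrullDim_of_isNoetherianRing] at h2
  simp only [ringKrullDim_eq_zero_of_field, Nat.card_eq_fintype_card, Fintype.card_fin, zero_add] at h2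
  have h3 : ((s + c : ℕ) : ℕ∞) ≤ Order.height l.head.1 + Order.coheight l.head.1 := by
    rw [add_comm s c, Nat.cast_add]
    refine add_le_add hh ?_
    rw [← hl]; exact h1
  have h4 : (((s + c : ℕ) : ℕ∞) : WithBot ℕ∞) ≤ ((N : ℕ∞) : WithBot ℕ∞) :=
    le_trans (WithBot.coe_le_coe.2 h3) h2
  exact_mod_cast h4

end BB

end

section
open MvPolynomial

namespace BB

set_option linter.unusedSectionVars false
variable {k : Type} [Field k] {N D : ℕ} {ι : Type} [Fintype ι]

lemma hom_iff {e : ℕ} {f : MvPolynomial (Fin N) k} : f.IsHomogeneous e ↔ ∀ u, coeff u f ≠ 0 → u.degree = e := by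
  constructor
  · intro h u hu
    by_contra hc
    exact hu (h.coeff_eq_zero hc)
  · intro h u hu
    have h3 : Finsupp.weight (fun _ => 1) u = u.degree :=
        (DFunLike.congr_fun (Finsupp.degree_eq_weight_one (R := ℕ)) u).symm
    exact h3.trans (h u hu)

section upper
variable {R : Type} [CommRing R] [Algebra k R] {s t : ℕ}

noncomputable def bx (g : MvPolynomial (Fin s) k →ₐ[k] R) (r : Fin t → R) (E : ℕ) : Submodule k R :=
  Submodule.span k (Set.range fun x : Fin t × (Fin s → Fin (E+1)) =>
    g (monomial (Finsupp.equivFunOnFinite.symm fun i => (x.2 i : ℕ)) 1) * r x.1)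

lemma bx_mon (g : MvPolynomial (Fin s) k →ₐ[k] R) (r : Fin t → R) (E : ℕ) (j : Fin t) (u : Fin s →₀ ℕ)
    (hu : ∀ i, u i ≤ E) : g (monomial u 1) * r j ∈ bx g r E := by
  apply Submodule.subset_span
  refine ⟨⟨j, fun i => ⟨u i, Nat.lt_succ_of_le (hu i)⟩⟩, ?_⟩
  have : (Finsupp.equivFunOnFinite.symm fun i => u i) = u := by ext i; simp
  simp only [this]

lemma bx_pol (g : MvPolynomial (Fin s) k →ₐ[k] R) (r : Fin t → R) (E : ℕ) (j : Fin t) (f : MvPolynomial (Fin s) k)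
    (hf : ∀ u ∈ f.support, ∀ i, u i ≤ E) : g f * r j ∈ bx g r E := by
  rw [f.as_sum, map_sum, Finset.sum_mul]
  refine Submodule.sum_mem _ fun u hu => ?_
  have : monomial u (coeff u f) = coeff u f • monomial u (1 : k) := by
    rw [smul_monomial, smul_eq_mul, mul_one]
  rw [this, map_smul, smul_mul_assoc]
  exact Submodule.smul_mem _ _ (bx_mon g r E j u (hf u hu))

instance bx_fd (g : MvPolynomial (Fin s) k →ₐ[k] R) (r : Fin t → R) (E : ℕ) : FiniteDimensional k (bx g r E) :=
  FiniteDimensional.span_of_finite k (Set.finite_range _)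

lemma bx_dim (g : MvPolynomial (Fin s) k →ₐ[k] R) (r : Fin t → R) (E : ℕ) :
    Module.finrank k (bx g r E) ≤ t * (E+1)^s := by
  refine (finrank_range_le_card _).trans ?_
  simp

lemma upper (g : MvPolynomial (Fin s) k →ₐ[k] R) (hg : g.Finite) (π : MvPolynomial (Fin N) k →ₐ[k] R) :
    ∃ (t E : ℕ) (r : Fin t → R), ∀ M (u : Fin N →₀ ℕ), u.degree ≤ M → π (monomial u 1) ∈ bx g r ((M+1) * E) := by
  letI := g.toRingHom.toAlgebra
  have hfin : Module.Finite (MvPolynomial (Fin s) k) R := hg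
  obtain ⟨t, r, hr⟩ := Module.Finite.exists_fin (R := MvPolynomial (Fin s) k) (M := R)
  have key : ∀ x : R, ∃ c : Fin t → MvPolynomial (Fin s) k, ∑ i, g (c i) * r i = x := by
    intro x
    have : x ∈ Submodule.span (MvPolynomial (Fin s) k) (Set.range r) := by rw [hr]; trivial
    rw [Submodule.mem_span_range_iff_exists_fun] at this
    obtain ⟨c, hc⟩ := this
    exact ⟨c, hc⟩
  choose c hc using key
  let dg (f : MvPolynomial (Fin s) k) : ℕ := f.totalDegree
  have hdg : ∀ (f : MvPolynomial (Fin s) k) (u) (_ : u ∈ f.support) (i), u i ≤ f.totalDegree := by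
    intro f u hu i
    refine le_trans ?_ (le_totalDegree hu)
    exact Finsupp.le_degree i u
  let E : ℕ := ∑ j, (c 1 j).totalDegree + ∑ a : Fin N, ∑ i, ∑ j, (c (π (X a) * r i) j).totalDegree
  have hE1 : ∀ j, (c 1 j).totalDegree ≤ E := fun j =>
    (Finset.single_le_sum (f := fun j => (c 1 j).totalDegree) (fun _ _ => Nat.zero_le _) (Finset.mem_univ j)).trans (Nat.le_add_right _ _)
  have hE2 : ∀ a i j, (c (π (X a) * r i) j).totalDegree ≤ E := fun a i j => by
    refine le_trans ?_ (Nat.le_add_left _ _)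
    refine le_trans ?_ (Finset.single_le_sum (f := fun a => ∑ i, ∑ j, (c (π (X a) * r i) j).totalDegree) (fun _ _ => Nat.zero_le _) (Finset.mem_univ a))
    refine le_trans ?_ (Finset.single_le_sum (f := fun i => ∑ j, (c (π (X a) * r i) j).totalDegree) (fun _ _ => Nat.zero_le _) (Finset.mem_univ i))
    exact (Finset.single_le_sum (f := fun j => (c (π (X a) * r i) j).totalDegree) (fun _ _ => Nat.zero_le _) (Finset.mem_univ j))
  have h1 : ∀ F, E ≤ F → (1 : R) ∈ bx g r F := by
    intro F hF
    rw [← hc 1]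
    exact Submodule.sum_mem _ fun j _ => bx_pol g r F j _ fun u hu i => (hdg _ u hu i).trans ((hE1 j).trans hF)
  have h2 : ∀ F a x, x ∈ bx g r F → π (X a) * x ∈ bx g r (F + E) := by
    intro F a x hx
    induction hx using Submodule.span_induction with
    | mem x hx =>
      obtain ⟨⟨i, u⟩, rfl⟩ := hx
      dsimp only
      rw [mul_left_comm, ← hc (π (X a) * r i), Finset.mul_sum]
      refine Submodule.sum_mem _ fun j _ => ?_
      rw [← mul_assoc, ← map_mul]
      refine bx_pol g r _ j _ fun w hw i' => ?_
      have := support_mul _ _ hw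
      rw [Finset.mem_add] at this
      obtain ⟨y, hy, z, hz, rfl⟩ := this
      have hy' := support_monomial_subset hy
      rw [Finset.mem_singleton] at hy'
      subst hy'
      have h3 := (hdg _ z hz i').trans (hE2 a i j)
      have h4 := (u i').2
      simp
      omega
    | zero => simp
    | add x y _ _ hx hy => rw [mul_add]; exact Submodule.add_mem _ hx hy
    | smul a x _ hx => rw [mul_smul_comm]; exact Submodule.smul_mem _ _ hx
  refine ⟨t, E, r, fun M => ?_⟩
  induction M with
  | zero =>
    intro u hu
    have : u = 0 := by rwa [Nat.le_zero, Finsupp.degree_eq_zero_iff] at hu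
    subst this
    simpa using h1 E le_rfl
  | succ M ih =>
    intro u hu
    by_cases h0 : u = 0
    · subst h0
      have := h1 ((M+1+1)*E) (Nat.le_mul_of_pos_left _ (by omega))
      simpa using this
    · obtain ⟨a, ha⟩ := Finsupp.ne_iff.1 h0
      have hle : Finsupp.single a 1 ≤ u := by
        rw [Finsupp.single_le_iff]; exact Nat.one_le_iff_ne_zero.2 ha
      obtain ⟨w, rfl⟩ := exists_add_of_le hle
      rw [map_add, Finsupp.degree_single] at hu
      have := h2 _ a _ (ih w (by omega))
      rw [← map_mul, X, monomial_mul, one_mul] at this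
      convert this using 2
      ring

end upper

section lower

def TM (k : Type) [Field k] (N M : ℕ) : Submodule k (MvPolynomial (Fin N) k) where
  carrier := {f | ∀ u, coeff u f ≠ 0 → u.degree ≤ M}
  zero_mem' := by intro u hu; simp at hu
  add_mem' := by
    intro f g hf hg u hu
    by_contra hc
    apply hu
    rw [coeff_add, not_not.1 (mt (hf u) hc), not_not.1 (mt (hg u) hc), add_zero]
  smul_mem' := by
    intro c f hf u hu
    apply hf u
    rintro h
    apply hu
    rw [coeff_smul, h, smul_zero]

lemma upper2 {R : Type} [CommRing R] [Algebra k R] {s : ℕ} (g : MvPolynomial (Fin s) k →ₐ[k] R) (hg : g.Finite)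
    (π : MvPolynomial (Fin N) k →ₐ[k] R) :
    ∃ B : ℕ, ∀ M, Module.finrank k ((TM k N M).map π.toLinearMap) ≤ B * (M+1)^s := by
  obtain ⟨t, E, r, h⟩ := upper g hg π
  refine ⟨t * (E+1)^s, fun M => ?_⟩
  have hle : (TM k N M).map π.toLinearMap ≤ bx g r ((M+1)*E) := by
    rintro _ ⟨f, hf, rfl⟩
    show π f ∈ _
    rw [f.as_sum, map_sum]
    refine Submodule.sum_mem _ fun u hu => ?_
    have : monomial u (coeff u f) = coeff u f • monomial u (1 : k) := by
      rw [smul_monomial, smul_eq_mul, mul_one]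
    rw [this, map_smul]
    exact Submodule.smul_mem _ _ (h M u (hf u (mem_support_iff.1 hu)))
  refine (Submodule.finrank_mono hle).trans ((bx_dim _ _ _).trans ?_)
  rw [mul_assoc, ← mul_pow]
  gcongr
  nlinarith

instance TM_fd (M : ℕ) : FiniteDimensional k (TM k N M) := by
  have : TM k N M ≤ restrictTotalDegree (Fin N) k M := by
    intro f hf
    rw [mem_restrictTotalDegree, totalDegree]
    refine Finset.sup_le fun u hu => ?_
    exact hf u (mem_support_iff.1 hu)
  exact Submodule.finiteDimensional_of_le this

lemma TM_step (I : Ideal (MvPolynomial (Fin N) k)) (hI : ∀ e, ∀ f ∈ I, homogeneousComponent e f ∈ I) (M : ℕ) :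
    Module.finrank k (TM k N M ⊓ I.restrictScalars k : Submodule k (MvPolynomial (Fin N) k)) =
    ∑ e ∈ Finset.range (M+1), Module.finrank k (I.restrictScalars k ⊓ homogeneousSubmodule (Fin N) k e : Submodule k (MvPolynomial (Fin N) k)) := by
  induction M with
  | zero =>
    rw [Finset.sum_range_one]
    have : TM k N 0 ⊓ I.restrictScalars k = I.restrictScalars k ⊓ homogeneousSubmodule (Fin N) k 0 := by
      ext f
      constructor
      · rintro ⟨h1, h2⟩
        exact ⟨h2, hom_iff.2 fun u hu => Nat.le_zero.1 (h1 u hu)⟩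
      · rintro ⟨h1, h2⟩
        exact ⟨fun u hu => (hom_iff.1 h2 u hu).le, h1⟩
    rw [this]
  | succ M ih =>
    have e1 : TM k N (M+1) ⊓ I.restrictScalars k ⊓ LinearMap.ker (homogeneousComponent (M+1)) =
        TM k N M ⊓ I.restrictScalars k := by
      ext f
      constructor
      · rintro ⟨⟨h1, h2⟩, h3⟩
        refine ⟨fun u hu => ?_, h2⟩
        have := h1 u hu
        rcases Nat.lt_or_ge u.degree (M+1) with h | h
        · omega
        · exfalso
          apply hu
          have h4 := coeff_homogeneousComponent (M+1) f u
          rw [LinearMap.mem_ker.1 h3, if_pos (le_antisymm this h)] at h4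
          rw [← h4]; rfl
      · rintro ⟨h1, h2⟩
        refine ⟨⟨fun u hu => (h1 u hu).trans (by omega), h2⟩, ?_⟩
        apply LinearMap.mem_ker.2
        ext u
        rw [coeff_homogeneousComponent]
        split_ifs with h
        · by_contra hc
          have := h1 u hc
          omega
        · rfl
    have e2 : (TM k N (M+1) ⊓ I.restrictScalars k).map (homogeneousComponent (M+1)) =
        I.restrictScalars k ⊓ homogeneousSubmodule (Fin N) k (M+1) := by
      ext f
      constructor
      · rintro ⟨g, ⟨h1, h2⟩, rfl⟩
        exact ⟨hI _ _ h2, homogeneousComponent_isHomogeneous _ _⟩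
      · rintro ⟨h1, h2⟩
        refine ⟨f, ⟨fun u hu => ?_, h1⟩, ?_⟩
        · exact (hom_iff.1 h2 u hu).le
        · exact homogeneousComponent_eq_self h2
    have fd : FiniteDimensional k (TM k N (M+1) ⊓ I.restrictScalars k : Submodule k (MvPolynomial (Fin N) k)) :=
      Submodule.finiteDimensional_of_le inf_le_left
    rw [Finset.sum_range_succ, ← ih, rk_null (homogeneousComponent (M+1)), e1, e2, add_comm]

lemma growth_alg (I : Ideal (MvPolynomial (Fin N) k)) (hI : ∀ e, ∀ f ∈ I, homogeneousComponent e f ∈ I) {s : ℕ}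
    (g : MvPolynomial (Fin s) k →ₐ[k] (MvPolynomial (Fin N) k ⧸ I)) (hg : g.Finite) :
    ∃ B : ℕ, ∀ M, ∑ e ∈ Finset.range (M+1), hh k N e ≤
      ∑ e ∈ Finset.range (M+1), Module.finrank k (I.restrictScalars k ⊓ homogeneousSubmodule (Fin N) k e : Submodule k (MvPolynomial (Fin N) k))
      + B * (M+1)^s := by
  obtain ⟨B, hB⟩ := upper2 g hg (Ideal.Quotient.mkₐ k I)
  refine ⟨B, fun M => ?_⟩
  have h1 := TM_step (⊤ : Ideal (MvPolynomial (Fin N) k)) (fun _ _ _ => trivial) M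
  have h2 := TM_step I hI M
  have e0 : ∀ e, Module.finrank k ((⊤ : Ideal (MvPolynomial (Fin N) k)).restrictScalars k ⊓
      homogeneousSubmodule (Fin N) k e : Submodule k (MvPolynomial (Fin N) k)) = hh k N e := fun e =>
    congrArg (fun W : Submodule k (MvPolynomial (Fin N) k) => Module.finrank k W)
      (by rw [Submodule.restrictScalars_top, top_inf_eq])
  simp only [e0] at h1
  rw [Submodule.restrictScalars_top, inf_top_eq] at h1
  have h3 := rk_null (Ideal.Quotient.mkₐ k I).toLinearMap (TM k N M)
  have h4 : LinearMap.ker (Ideal.Quotient.mkₐ k I).toLinearMap = I.restrictScalars k := by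
    ext f
    simp [Ideal.Quotient.eq_zero_iff_mem]
  rw [h4] at h3
  have := hB M
  omega
end lower

end BB

end

section
open MvPolynomial

namespace BB

set_option linter.unusedSectionVars false
variable {k : Type} [Field k] {N D : ℕ} {ι : Type} [Fintype ι]

lemma hh_zero (r : ℕ) : hh k (r+1) 0 = hh k r 0 := by
  have := congrArg (PowerSeries.coeff 0) (HS_succ (k := k) r)
  rw [sub_mul, one_mul, map_sub, PowerSeries.coeff_zero_X_mul] at this
  simp only [HS, PowerSeries.coeff_mk, sub_zero] at this
  exact_mod_cast this

lemma hh_succ (r M : ℕ) : hh k (r+1) (M+1) = hh k (r+1) M + hh k r (M+1) := by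
  have := congrArg (PowerSeries.coeff (M+1)) (HS_succ (k := k) r)
  rw [sub_mul, one_mul, map_sub, PowerSeries.coeff_succ_X_mul] at this
  simp only [HS, PowerSeries.coeff_mk] at this
  omega

lemma hh_zero0 (e : ℕ) : hh k 0 e = if e = 0 then 1 else 0 := by
  have := congrArg (PowerSeries.coeff e) (HS_zero (k := k))
  rw [PowerSeries.coeff_one] at this
  simp only [HS, PowerSeries.coeff_mk] at this
  split_ifs at this ⊢ <;> exact_mod_cast this

lemma hh_all0 (r : ℕ) : hh k r 0 = 1 := by
  induction r with
  | zero => simp [hh_zero0]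
  | succ r ih => rw [hh_zero, ih]

lemma hh_choose (r M : ℕ) : hh k (r+1) M = (M + r).choose r := by
  induction r generalizing M with
  | zero =>
    induction M with
    | zero => simp [hh_all0]
    | succ M ih => rw [hh_succ, ih, hh_zero0]; simp
  | succ r ih =>
    induction M with
    | zero => simp [hh_all0]
    | succ M ihM =>
      rw [hh_succ, ihM, ih]
      have : M + 1 + (r+1) = (M + (r + 1)) + 1 := by ring
      rw [this, Nat.choose_succ_succ, add_comm]
      congr 2
      ring

lemma hh_sum (r M : ℕ) : ∑ m ∈ Finset.range (M+1), hh k r m = hh k (r+1) M := by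
  induction M with
  | zero => simp [hh_zero]
  | succ M ih => rw [Finset.sum_range_succ, ih, hh_succ]

noncomputable def Hd (k : Type) [Field k] (D N : ℕ) : PowerSeries ℤ := PowerSeries.mk fun m => (hh k N (m + D + 1) : ℤ)

lemma Hd_eq (D N : ℕ) : Hd k D N * (1 - PowerSeries.X)^N =
    ∑ j ∈ Finset.range N, PowerSeries.C ((D + j).choose j : ℤ) * (1 - PowerSeries.X)^j := by
  induction N with
  | zero =>
    ext m
    simp [Hd, hh_zero0]
  | succ n ih =>
    have key : (1 - PowerSeries.X) * Hd k D (n+1) = Hd k D n + PowerSeries.C ((D+n).choose n : ℤ) := by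
      ext m
      rw [sub_mul, one_mul, map_sub, map_add]
      rcases m with _ | m
      · simp only [Hd, PowerSeries.coeff_mk, PowerSeries.coeff_zero_X_mul, PowerSeries.coeff_C]
        rw [← hh_choose (k := k)]
        have := hh_succ (k := k) n (0 + D)
        simp at this ⊢
        omega
      · simp only [Hd, PowerSeries.coeff_mk, PowerSeries.coeff_succ_X_mul, PowerSeries.coeff_C]
        have := hh_succ (k := k) n (m + 1 + D)
        have e : m + D + 1 = m + 1 + D := by ring
        rw [e]
        simp
        omega
    rw [pow_succ', ← mul_assoc, mul_comm (Hd k D (n+1)), key, add_mul, ih, Finset.sum_range_succ]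

lemma pow_HS (j n : ℕ) : (1 - PowerSeries.X)^j * HS k (n + j) = HS k n := by
  induction j with
  | zero => simp
  | succ j ih => rw [pow_succ, mul_assoc, ← add_assoc, HS_succ, ih]

namespace Cx

lemma b_le {b : ℕ → ℕ} (hr : ∀ j, j + 1 < N → (j + 1) * b (j + 1) ≤ (D + 1 + j) * b j) (h0 : 0 < N → b 0 ≤ 1) :
    ∀ j, j < N → b j ≤ (D + j).choose j := by
  intro j
  induction j with
  | zero => intro h; simpa using h0 h
  | succ j ih =>
    intro h
    have h1 := ih (by omega)
    have h2 := hr j h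
    have h3 : (D + (j+1)).choose (j+1) * (j+1) = (D + 1 + j) * (D + j).choose j := by
      have := Nat.add_one_mul_choose_eq (D+j) j
      rw [← add_assoc, ← this]; ring
    have h4 : (j+1) * b (j+1) ≤ (j+1) * (D + (j+1)).choose (j+1) := by
      rw [mul_comm (j+1) (Nat.choose _ _), h3]
      exact h2.trans (Nat.mul_le_mul_left _ h1)
    exact Nat.le_of_mul_le_mul_left h4 (by omega)

theorem growth {C : Cx k N D ι} {a0 : ι} (h : C.R1 a0) {b : ℕ → ℕ}
    (hP : C.PS a0 * (1 - PowerSeries.X) ^ N =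
        ∑ j ∈ Finset.range N, PowerSeries.C (b j : ℤ) * (1 - PowerSeries.X) ^ j)
    (hr : ∀ j, j + 1 < N → (j + 1) * b (j + 1) ≤ (D + 1 + j) * b j) (h0 : 0 < N → b 0 ≤ 1)
    (hJ : C.J a0 ≠ ⊤) {q : ℕ}
    (hq : ∀ s : ℕ, (s : WithBot ℕ∞) ≤ ringKrullDim (MvPolynomial (Fin N) k ⧸ C.J a0) → s + q ≤ N) :
    q ≤ N ∧ ∀ j < q, b j = (D + j).choose j := by
  obtain ⟨s, hs, g, hg⟩ := noeth _ hJ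
  have hsq := hq s hs
  refine ⟨by omega, ?_⟩
  intro j0 hj0
  by_contra hne
  have hle := b_le (D := D) hr h0
  let c : ℕ → ℕ := fun j => (D + j).choose j - b j
  have hc : ∀ j, j < N → (c j : ℤ) = (D+j).choose j - b j := fun j hj => by
    simp only [c]; rw [Nat.cast_sub (hle j hj)]
  have hcj : 1 ≤ c j0 := by
    have := hle j0 (by omega)
    simp only [c]; omega
  obtain ⟨B, hB⟩ := growth_alg (C.J a0) (fun e f hf => J_comp h e hf) g hg
  have hS : Hd k D N - C.PS a0 = ∑ j ∈ Finset.range N, PowerSeries.C (c j : ℤ) * HS k (N - j) := by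
    have e1 : (Hd k D N - C.PS a0) * (1 - PowerSeries.X)^N =
        ∑ j ∈ Finset.range N, PowerSeries.C (c j : ℤ) * (1 - PowerSeries.X)^j := by
      rw [sub_mul, Hd_eq, hP, ← Finset.sum_sub_distrib]
      refine Finset.sum_congr rfl fun j hj => ?_
      rw [hc j (Finset.mem_range.1 hj), map_sub, sub_mul]
    have e2 := congrArg (· * HS k N) e1
    simp only [mul_assoc] at e2
    rw [mul_comm _ (HS k N), HS_eq, mul_one, Finset.sum_mul] at e2
    rw [e2]
    refine Finset.sum_congr rfl fun j hj => ?_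
    have := pow_HS (k := k) j (N - j)
    rw [Nat.sub_add_cancel (Finset.mem_range.1 hj).le] at this
    rw [mul_assoc, this]
  have hS2 : ∀ m, hh k (N - j0) m + Module.finrank k (C.Je a0 (m + D + 1)) ≤ hh k N (m + D + 1) := by
    intro m
    have e := congrArg (PowerSeries.coeff m) hS
    rw [map_sub, map_sum] at e
    simp only [Hd, PS, PowerSeries.coeff_mk, PowerSeries.coeff_C_mul, HS] at e
    have e3 : (hh k (N - j0) m : ℤ) ≤ ∑ j ∈ Finset.range N, (c j : ℤ) * (hh k (N - j) m : ℤ) := by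
      refine le_trans ?_ (Finset.single_le_sum (f := fun j => (c j : ℤ) * (hh k (N - j) m : ℤ)) (fun _ _ => by positivity) (Finset.mem_range.2 (show j0 < N by omega)))
      have : hh k (N - j0) m ≤ c j0 * hh k (N - j0) m := Nat.le_mul_of_pos_left _ hcj
      exact_mod_cast this
    rw [← e] at e3
    omega
  have hJe : ∀ e, Module.finrank k (C.Je a0 e) ≤ hh k N e := fun e =>
    Submodule.finrank_mono inf_le_right
  -- sum
  have hsum : ∀ M, hh k (N - j0 + 1) M + ∑ e ∈ Finset.range (M+D+1+1), Module.finrank k (C.Je a0 e) ≤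
      ∑ e ∈ Finset.range (M+D+1+1), hh k N e := by
    intro M
    induction M with
    | zero =>
      rw [Finset.sum_range_succ, Finset.sum_range_succ (fun e => hh k N e)]
      have h1 := hS2 0
      have h2 := Finset.sum_le_sum fun e (_ : e ∈ Finset.range (0 + D + 1)) => hJe e
      have h3 := hh_zero (k := k) (N - j0)
      omega
    | succ M ih =>
      have e : M + 1 + D + 1 + 1 = (M + D + 1 + 1) + 1 := by ring
      rw [e, Finset.sum_range_succ _ (M+D+1+1), Finset.sum_range_succ (fun e => hh k N e) (M+D+1+1)]
      have h1 := hS2 (M+1)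
      have h3 := hh_succ (k := k) (N - j0) M
      have e : M + 1 + D + 1 = (M + D + 1 + 1) := by ring
      rw [e] at h1
      omega
  have hfin : ∀ M, hh k (N - j0 + 1) M ≤ B * (M + D + 2)^s := by
    intro M
    have h1 := hsum M
    have h2 : ∑ e ∈ Finset.range (M+D+1+1), hh k N e ≤
      ∑ e ∈ Finset.range (M+D+1+1), Module.finrank k (C.Je a0 e) + B * (M+D+2)^s := hB (M + D + 1)
    omega
  obtain ⟨r, hr'⟩ : ∃ r, N - j0 = s + 1 + r := ⟨N - j0 - (s+1), by omega⟩
  have hlow : ∀ M, (M+1)^(s+1) ≤ (N-j0).factorial * (B * ((M+1) * (D+2))^s) := by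
    intro M
    have h1 := hfin M
    rw [hh_choose] at h1
    have h2 := Nat.pow_succ_le_ascFactorial (M+1) (N - j0)
    rw [Nat.ascFactorial_eq_factorial_mul_choose] at h2
    calc (M+1)^(s+1) ≤ (M+1)^(N-j0) := Nat.pow_le_pow_right (by omega) (by omega)
      _ ≤ _ := h2
      _ ≤ (N-j0).factorial * (B * (M + D + 2)^s) := Nat.mul_le_mul_left _ h1
      _ ≤ _ := by
        gcongr
        nlinarith
  let K := (N-j0).factorial * (B * (D+2)^s)
  have := hlow K
  rw [mul_pow, pow_succ'] at this
  have h5 : (K+1) * (K+1)^s ≤ K * (K+1)^s := by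
    calc _ ≤ _ := this
      _ = _ := by simp only [K]; ring
  have := Nat.le_of_mul_le_mul_right h5 (by positivity)
  omega

end Cx
end BB

end

section
open MvPolynomial
open scoped Pointwise

namespace BB

set_option linter.unusedSectionVars false
variable {k : Type} [Field k] {N D : ℕ} {ι : Type} [Fintype ι]

lemma cc_ph (s : k) (f : MvPolynomial (Fin (N+1)) k) : constantCoeff (ph N s f) = constantCoeff f := by
  have : (constantCoeff.comp (ph N s).toRingHom : MvPolynomial (Fin (N+1)) k →+* k) = constantCoeff := by
    apply MvPolynomial.ringHom_ext
    · intro r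
      show constantCoeff (ph N s (C r)) = _
      rw [← algebraMap_eq, AlgHom.commutes, algebraMap_eq]; simp
    · intro a
      show constantCoeff (ph N s (X a)) = _
      simp only [ph, aeval_X, map_sub, map_mul, constantCoeff_X]
      have h1 : constantCoeff ((Fin.cons 0 X : Fin (N+1) → MvPolynomial (Fin N) k) a) = 0 := by
        refine Fin.cases ?_ (fun i => ?_) a <;> simp
      have h2 : constantCoeff ((Fin.snoc X 0 : Fin (N+1) → MvPolynomial (Fin N) k) a) = 0 := by
        refine Fin.lastCases ?_ (fun i => ?_) a <;> simp
      rw [h1, h2]; simp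
  exact DFunLike.congr_fun this f

lemma ph_mulVec (s : k) (A : Matrix ι ι (MvPolynomial (Fin (N+1)) k)) (v : ι → MvPolynomial (Fin (N+1)) k) (a : ι) :
    ph N s (A.mulVec v a) = (A.map (ph N s)).mulVec (fun b => ph N s (v b)) a := by
  simp [Matrix.mulVec, dotProduct, map_sum, map_mul]

theorem kill : ∀ (N j : ℕ) (A : Matrix ι ι (MvPolynomial (Fin N) k)) (g : ι → ℕ)
    (_ : ∀ a b, A a b ≠ 0 → g b = g a + 1) (_ : A * A = 0) (_ : ∀ a b, constantCoeff (A a b) = 0)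
    (_ : ∀ v, (∀ a, v a ≠ 0 → j < g a) → A.mulVec v = 0 → ∃ w, A.mulVec w = v) (a : ι), g a ≤ N + j := by
  classical
  intro N
  induction N with
  | zero =>
    intro j A g hg hA hc hex a
    by_contra hlt
    have hA0 : A = 0 := by
      ext1 x y
      have h1 := hc x y
      have h2 := MvPolynomial.eq_C_of_isEmpty (A x y)
      rw [h2]
      have : constantCoeff (A x y) = coeff 0 (A x y) := rfl
      rw [← this, h1]; simp
    obtain ⟨w, hw⟩ := hex (Pi.single a 1) (fun x hx => by
      by_cases h : x = a
      · subst h; omega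
      · simp [h] at hx) (by rw [hA0, Matrix.zero_mulVec])
    rw [hA0, Matrix.zero_mulVec] at hw
    have := congrFun hw a
    simp at this
  | succ N ih =>
    intro j A g hg hA hc hex a
    have hdeg : ∀ (v : ι → MvPolynomial (Fin (N+1)) k) (a : ι), A.mulVec v a ≠ 0 → ∃ b, v b ≠ 0 ∧ g b = g a + 1 := by
      intro v a h
      obtain ⟨b, -, hb⟩ := Finset.exists_ne_zero_of_sum_ne_zero (h : ∑ b, A a b * v b ≠ 0)
      exact ⟨b, right_ne_zero_of_mul hb, hg a b (left_ne_zero_of_mul hb)⟩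
    have := ih (j+1) (A.map (ph N (0:k))) g ?_ ?_ ?_ ?_ a
    · omega
    · intro a b h
      apply hg a b
      rintro h0
      apply h
      simp [h0]
    · have := congrArg (fun B : Matrix ι ι (MvPolynomial (Fin (N+1)) k) => B.map (ph N (0:k))) hA
      simp only [Matrix.map_mul] at this
      rw [this]
      ext1 x y
      simp
    · intro a b
      rw [Matrix.map_apply, cc_ph, hc]
    · intro vb hvb hAv
      let v : ι → MvPolynomial (Fin (N+1)) k := fun a => ps N 0 (vb a)
      have hv : ∀ a, v a ≠ 0 → j + 1 < g a := by
        intro a h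
        apply hvb
        rintro h0
        apply h
        simp [v, h0]
      have hd : ∀ a, ∃ u, ll (N+1) (0:k) * u = A.mulVec v a ∧ (A.mulVec v a = 0 → u = 0) := by
        intro a
        by_cases h0 : A.mulVec v a = 0
        · exact ⟨0, by simp [h0], fun _ => rfl⟩
        · have : ll (N+1) (0:k) ∣ A.mulVec v a := by
            rw [ll_dvd_iff, ph_mulVec]
            simp only [v, ph_ps]
            rw [hAv]; rfl
          obtain ⟨u, hu⟩ := this
          exact ⟨u, hu.symm, fun h => absurd h h0⟩
      choose u hu1 hu2 using hd
      have hu3 : ll (N+1) (0:k) • u = A.mulVec v := by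
        ext1 a; exact hu1 a
      have hus : ∀ a, u a ≠ 0 → j < g a := by
        intro a h
        obtain ⟨b, hb1, hb2⟩ := hdeg v a (fun h0 => h (hu2 a h0))
        have := hv b hb1
        omega
      have hAu : A.mulVec u = 0 := by
        have h1 : A.mulVec (ll (N+1) (0:k) • u) = 0 := by
          rw [hu3, Matrix.mulVec_mulVec, hA, Matrix.zero_mulVec]
        rw [Matrix.mulVec_smul] at h1
        exact (smul_eq_zero.1 h1).resolve_left (ll_ne_zero 0)
      obtain ⟨w, hw⟩ := hex u hus hAu
      let w' : ι → MvPolynomial (Fin (N+1)) k := fun a => if j + 1 < g a then w a else 0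
      have hw' : A.mulVec w' = u := by
        ext1 a
        by_cases ha : j < g a
        · rw [← hw]
          refine Finset.sum_congr rfl fun b _ => ?_
          by_cases hb : A a b = 0
          · simp [hb]
          · have := hg a b hb
            simp only [w']
            rw [if_pos (by omega)]
        · have h1 : u a = 0 := not_not.1 (mt (hus a) ha)
          rw [h1]
          refine Finset.sum_eq_zero fun b _ => ?_
          by_cases hb : A a b = 0
          · simp [hb]
          · have := hg a b hb
            simp only [w']
            rw [if_neg (by omega), mul_zero]
      obtain ⟨x, hx⟩ := hex (v - ll (N+1) (0:k) • w') (fun a h => by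
        by_contra hc
        apply h
        have h1 : v a = 0 := not_not.1 (mt (hv a) (by omega))
        have h2 : w' a = 0 := if_neg (by omega)
        simp [h1, h2]) (by
          rw [Matrix.mulVec_sub, Matrix.mulVec_smul, hw', hu3, sub_self])
      refine ⟨fun a => ph N 0 (x a), ?_⟩
      ext1 a
      rw [← ph_mulVec, hx]
      simp [v, ph_ps, ph_ll_self]

structure AB (N : ℕ) (M : Type) [AddCommGroup M] [Module (MvPolynomial (Fin N) k) M] (κ : Type) [Fintype κ]
    (L : ℕ) where
  A : Matrix κ κ (MvPolynomial (Fin N) k)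
  g : κ → ℕ
  hg : ∀ a b, A a b ≠ 0 → g b = g a + 1
  sq : A * A = 0
  cc : ∀ a b, constantCoeff (A a b) = 0
  π : (κ → MvPolynomial (Fin N) k) →ₗ[MvPolynomial (Fin N) k] M
  H : ∀ v, A.mulVec v = 0 → (π v = 0 ↔ ∃ w, A.mulVec w = v)
  surj : ∀ m, ∃ v, A.mulVec v = 0 ∧ π v = m
  pos : ∀ v, (∀ a, v a ≠ 0 → 0 < g a) → π v = 0
  top : ∃ a, g a = L

lemma AB.le {M : Type} [AddCommGroup M] [Module (MvPolynomial (Fin N) k) M] {L : ℕ}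
    (X : AB (k := k) N M ι L) : L ≤ N := by
  obtain ⟨a, ha⟩ := X.top
  have := kill N 0 X.A X.g X.hg X.sq X.cc (fun v hv h0 => (X.H v h0).1 (X.pos v hv)) a
  omega

open Classical in
noncomputable def AB.cone {M : Type} [AddCommGroup M] [Module (MvPolynomial (Fin N) k) M] {L : ℕ}
    (X : AB (k := k) N M ι L) (y : MvPolynomial (Fin N) k) (hy : constantCoeff y = 0) (hr : IsSMulRegular M y) :
    AB (k := k) N (QuotSMulTop y M) (ι ⊕ ι) (L+1) where
  A := Matrix.fromBlocks X.A (y • 1) 0 (-X.A)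
  g := Sum.elim X.g (fun a => X.g a + 1)
  hg := by
    rintro (a | a) (b | b) h
    · exact X.hg a b h
    · by_cases hab : a = b
      · subst hab; rfl
      · exfalso; apply h; simp [hab]
    · exfalso; apply h; simp
    · have : X.A a b ≠ 0 := by
        rintro h0; apply h; simp [h0]
      have := X.hg a b this
      simp [this]
  sq := by
    rw [Matrix.fromBlocks_multiply]
    simp [X.sq]
  cc := by
    rintro (a | a) (b | b)
    · exact X.cc a b
    · simp [hy]
    · simp
    · simp [X.cc a b]
  π := (Submodule.mkQ _) ∘ₗ X.π ∘ₗ LinearMap.funLeft _ _ Sum.inl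
  H := by
    intro v hv
    obtain ⟨v1, v2, rfl⟩ : ∃ v1 v2, v = Sum.elim v1 v2 := ⟨_, _, (Sum.elim_comp_inl_inr v).symm⟩
    rw [Matrix.fromBlocks_mulVec] at hv
    have hv1 : X.A.mulVec v1 + y • v2 = 0 := by
      ext1 a
      have := congrFun hv (Sum.inl a)
      simpa [Matrix.smul_mulVec] using this
    have hv2 : X.A.mulVec v2 = 0 := by
      ext1 a
      have := congrFun hv (Sum.inr a)
      simpa [Matrix.neg_mulVec] using this
    have hπA : ∀ x, X.π (X.A.mulVec x) = 0 := fun x =>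
      (X.H _ (by rw [Matrix.mulVec_mulVec, X.sq, Matrix.zero_mulVec])).2 ⟨x, rfl⟩
    have hcomp : (Sum.elim v1 v2 : ι ⊕ ι → MvPolynomial (Fin N) k) ∘ Sum.inl = v1 := by ext1; rfl
    have hstep : ((Submodule.mkQ (y • (⊤ : Submodule (MvPolynomial (Fin N) k) M))) ∘ₗ X.π ∘ₗ LinearMap.funLeft _ _ Sum.inl) (Sum.elim v1 v2) = 0 ↔ X.π v1 ∈ y • (⊤ : Submodule (MvPolynomial (Fin N) k) M) := by
      simp only [LinearMap.comp_apply, LinearMap.funLeft, LinearMap.coe_mk, AddHom.coe_mk, hcomp]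
      rw [Submodule.mkQ_apply, Submodule.Quotient.mk_eq_zero]
    rw [hstep, Submodule.mem_smul_pointwise_iff_exists]
    constructor
    · rintro ⟨m, -, hm⟩
      have h1 : X.π v2 = 0 := by
        have := congrArg X.π hv1
        rw [map_add, hπA, zero_add, map_smul, map_zero] at this
        exact hr (by simpa using this)
      obtain ⟨u, hu⟩ := (X.H v2 hv2).1 h1
      obtain ⟨z, hz, hzm⟩ := X.surj (m + X.π u)
      have h2 : X.A.mulVec (v1 + y • u - y • z) = 0 := by
        rw [Matrix.mulVec_sub, Matrix.mulVec_add, Matrix.mulVec_smul, Matrix.mulVec_smul, hz, hu, hv1]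
        simp
      have h3 : X.π (v1 + y • u - y • z) = 0 := by
        rw [map_sub, map_add, map_smul, map_smul, ← hm, hzm, smul_add]; abel
      obtain ⟨x, hx⟩ := (X.H _ h2).1 h3
      refine ⟨Sum.elim x (z - u), ?_⟩
      rw [Matrix.fromBlocks_mulVec]
      ext1 a
      rcases a with a | a
      · have := congrFun hx a
        simp [Matrix.smul_mulVec, Function.comp_def] at this ⊢
        rw [this]; ring
      · have h4 : (-X.A).mulVec (z - u) = v2 := by
          rw [Matrix.neg_mulVec, Matrix.mulVec_sub, hz, hu]; simp
        have h5 := congrFun h4 a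
        simp only [Sum.elim_inr, Matrix.zero_mulVec, zero_add, Sum.elim_comp_inr]
        exact h5
    · rintro ⟨w, hw⟩
      obtain ⟨w1, w2, rfl⟩ : ∃ v1 v2, w = Sum.elim v1 v2 := ⟨_, _, (Sum.elim_comp_inl_inr w).symm⟩
      rw [Matrix.fromBlocks_mulVec] at hw
      have hw1 : X.A.mulVec w1 + y • w2 = v1 := by
        ext1 a
        have := congrFun hw (Sum.inl a)
        simpa [Matrix.smul_mulVec] using this
      refine ⟨X.π w2, trivial, ?_⟩
      rw [← hw1, map_add, hπA, map_smul, zero_add]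
  surj := by
    intro m
    obtain ⟨m, rfl⟩ := Submodule.mkQ_surjective _ m
    obtain ⟨v, hv, rfl⟩ := X.surj m
    refine ⟨Sum.elim v 0, ?_, ?_⟩
    · rw [Matrix.fromBlocks_mulVec]
      ext1 a
      rcases a with a | a
      · simpa using congrFun hv a
      · simp
    · rfl
  pos := by
    intro v hv
    have : X.π (v ∘ Sum.inl) = 0 := X.pos _ fun a ha => hv (Sum.inl a) ha
    simp only [LinearMap.comp_apply, LinearMap.funLeft, LinearMap.coe_mk, AddHom.coe_mk, this, map_zero]
  top := by
    obtain ⟨a, ha⟩ := X.top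
    exact ⟨Sum.inr a, by simp [ha]⟩

theorem AB.reg : ∀ (rs : List (MvPolynomial (Fin N) k)) (ι : Type) [Fintype ι] (M : Type) [AddCommGroup M] [Module (MvPolynomial (Fin N) k) M] (L : ℕ)
    (_ : AB (k := k) N M ι L) (_ : ∀ x ∈ rs, constantCoeff x = 0) (_ : RingTheory.Sequence.IsWeaklyRegular M rs),
    L + rs.length ≤ N := by
  intro rs
  induction rs with
  | nil => intro ι _ M _ _ L X _ _; simpa using X.le
  | cons y rs ih =>
    intro ι _ M _ _ L X h1 h2
    rw [RingTheory.Sequence.isWeaklyRegular_cons_iff] at h2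
    have := ih _ _ _ (X.cone y (h1 y (by simp)) h2.1) (fun x hx => h1 x (by simp [hx])) h2.2
    rw [List.length_cons]; omega

end BB

end

section
open MvPolynomial

namespace BB

set_option linter.unusedSectionVars false

section gen
variable {S : Type} [CommRing S] {hom : ℕ → Set S} {M : Type} [AddCommGroup M] [Module S M]
  (res : MinGradedFreeRes S hom M)

abbrev Ix : Type := (i : ℕ) × (j : ℤ) × Fin (res.β i j)

lemma Ix_finite (p : ℕ) (hlen : ∀ i, p < i → res.β i = 0) : Finite (Ix res) := by
  rw [← Set.finite_univ_iff]
  refine Set.Finite.subset (s := ⋃ i ∈ Finset.range (p+1), ⋃ j ∈ (res.finβ i).toFinset,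
    Set.range (fun a : Fin (res.β i j) => (⟨i, j, a⟩ : Ix res))) ?_ ?_
  · exact Set.Finite.biUnion (Finset.finite_toSet _) fun i _ =>
      Set.Finite.biUnion (Finset.finite_toSet _) fun j _ => Set.finite_range _
  · rintro ⟨i, j, a⟩ -
    have h1 : res.β i j ≠ 0 := fun h => by rw [h] at a; exact a.elim0
    have h2 : i ≤ p := by
      by_contra hc
      exact h1 (by rw [hlen i (by omega)]; rfl)
    simp only [Set.mem_iUnion]
    exact ⟨i, Finset.mem_range.2 (by omega), j, by simpa using h1, a, rfl⟩

variable [Fintype (Ix res)]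

lemma Fi_fin (i : ℕ) : Finite ((j : ℤ) × Fin (res.β i j)) :=
  Finite.of_injective (fun x => (⟨i, x⟩ : Ix res)) (fun x y h => by simpa using h)

open Classical in
noncomputable def mA : Matrix (Ix res) (Ix res) S := fun a b =>
  if h : b.1 = a.1 + 1 then res.d a.1 (Finsupp.single (h ▸ b.2) 1) a.2 else 0

lemma mA_succ (i : ℕ) (x) (y) : mA res ⟨i, x⟩ ⟨i+1, y⟩ = res.d i (Finsupp.single y 1) x := by
  simp [mA]

lemma mA_ne (a b : Ix res) (h : b.1 ≠ a.1 + 1) : mA res a b = 0 := by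
  simp [mA, h]

noncomputable def sl (i : ℕ) : (Ix res → S) →ₗ[S] FreeMod S (res.β i) where
  toFun v := haveI := Fi_fin res i; Finsupp.equivFunOnFinite.symm fun x => v ⟨i, x⟩
  map_add' u v := by ext x; rfl
  map_smul' c v := by ext x; rfl

lemma sl_apply (i : ℕ) (v : Ix res → S) (x) : sl res i v x = v ⟨i, x⟩ := rfl

lemma mA_mulVec (v : Ix res → S) (i : ℕ) (x) : (mA res).mulVec v ⟨i, x⟩ = res.d i (sl res (i+1) v) x := by
  classical
  have := Fi_fin res (i+1)
  have := Fintype.ofFinite ((j : ℤ) × Fin (res.β (i+1) j))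
  have h1 : sl res (i+1) v = ∑ y, v ⟨i+1, y⟩ • Finsupp.single y (1:S) := by
    ext z
    simp [sl_apply, Finsupp.finsetSum_apply, Finsupp.single_apply]
  rw [h1, map_sum, Finsupp.finsetSum_apply]
  symm
  refine Fintype.sum_of_injective (fun y => (⟨i+1, y⟩ : Ix res)) (fun x y h => by simpa using h) _ _ ?_ ?_
  · rintro ⟨i', y⟩ hb
    by_cases h : i' = i + 1
    · subst h; exact absurd ⟨y, rfl⟩ hb
    · show mA res ⟨i,x⟩ ⟨i',y⟩ * v ⟨i',y⟩ = 0
      rw [mA_ne res ⟨i,x⟩ ⟨i',y⟩ h, zero_mul]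
  · intro y
    show _ = mA res ⟨i,x⟩ ⟨i+1,y⟩ * v ⟨i+1,y⟩
    rw [mA_succ, map_smul, Finsupp.smul_apply, smul_eq_mul, mul_comm]

lemma sl_mulVec (v : Ix res → S) (i : ℕ) : sl res i ((mA res).mulVec v) = res.d i (sl res (i+1) v) := by
  ext x
  rw [sl_apply, mA_mulVec]

lemma ext_sl {u v : Ix res → S} (h : ∀ i, sl res i u = sl res i v) : u = v := by
  ext1 ⟨i, x⟩
  have := DFunLike.congr_fun (h i) x
  exact this

lemma d_d (i : ℕ) (w) : res.d i (res.d (i+1) w) = 0 := by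
  have : res.d (i+1) w ∈ LinearMap.ker (res.d i) := by rw [← res.exact i]; exact ⟨w, rfl⟩
  exact this

lemma aug_d (w) : res.aug (res.d 0 w) = 0 := by
  have : res.d 0 w ∈ LinearMap.ker res.aug := by rw [← res.exact₀]; exact ⟨w, rfl⟩
  exact this

lemma mA_sq : mA res * mA res = 0 := by
  classical
  apply Matrix.ext_of_mulVec_single
  intro b
  rw [← Matrix.mulVec_mulVec]
  apply ext_sl
  intro i
  rw [sl_mulVec, sl_mulVec, d_d, Matrix.zero_mulVec, map_zero]

lemma mA_exact (v : Ix res → S) (hv : (mA res).mulVec v = 0) :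
    res.aug (sl res 0 v) = 0 ↔ ∃ w, (mA res).mulVec w = v := by
  constructor
  · intro h0
    have h : ∀ i, ∃ w, res.d i w = sl res i v := by
      intro i
      rcases i with _ | i
      · have : sl res 0 v ∈ LinearMap.ker res.aug := h0
        rw [← res.exact₀] at this
        exact this
      · have : sl res (i+1) v ∈ LinearMap.ker (res.d i) := by
          rw [LinearMap.mem_ker, ← sl_mulVec, hv, map_zero]
        rw [← res.exact i] at this
        exact this
    choose w hw using h
    let u : Ix res → S := fun b => match b with
      | ⟨0, _⟩ => 0
      | ⟨i+1, x⟩ => w i x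
    refine ⟨u, ?_⟩
    apply ext_sl
    intro i
    rw [sl_mulVec, ← hw i]
    congr 1
    ext x
    rfl
  · rintro ⟨w, rfl⟩
    rw [sl_mulVec, aug_d]

lemma cardIx [DecidableEq (Ix res)] (i : ℕ) : (Finset.univ.filter fun a : Ix res => a.1 = i).card = res.tB i := by
  have : (Finset.univ.filter fun a : Ix res => a.1 = i) =
      ((res.finβ i).toFinset.sigma fun j => (Finset.univ : Finset (Fin (res.β i j)))).image (fun x => (⟨i, x⟩ : Ix res)) := by
    ext ⟨i', j, a⟩
    simp only [Finset.mem_filter, Finset.mem_univ, true_and, Finset.mem_image, Finset.mem_sigma, and_true]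
    constructor
    · rintro rfl
      have h1 : res.β i' j ≠ 0 := fun h => by rw [h] at a; exact a.elim0
      exact ⟨⟨j, a⟩, by simpa using h1, rfl⟩
    · rintro ⟨x, -, hx⟩
      exact (congrArg Sigma.fst hx).symm
  rw [this, Finset.card_image_of_injective _ (fun x y h => by simpa using h), Finset.card_sigma]
  simp [MinGradedFreeRes.tB]

end gen

end BB

end

section
open MvPolynomial

namespace BB

set_option linter.unusedSectionVars false

section br
variable {k : Type} [Field k] {n D : ℕ} {I : Ideal (MvPolynomial (Fin n) k)}
    (res : MinGradedFreeRes (MvPolynomial (Fin n) k)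
      (fun m => {f | MvPolynomial.IsHomogeneous f m})
      (MvPolynomial (Fin n) k ⧸ I))

lemma be_ne {i : ℕ} {j : ℤ} (a : Fin (res.β i j)) : res.β i j ≠ 0 :=
  fun h => by rw [h] at a; exact a.elim0

noncomputable def toCx [Fintype (Ix res)]
    (h0 : ∀ j : ℤ, res.β 0 j = if j = 0 then 1 else 0)
    (hlin : ∀ i : ℕ, 1 ≤ i → ∀ j : ℤ, res.β i j ≠ 0 → j = (D : ℤ) + i) : Cx k n D (Ix res) where
  g a := a.1
  deg a := a.2.1.toNat
  A := mA res
  hom := by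
    have hnn : ∀ b : Ix res, 0 ≤ b.2.1 := by
      rintro ⟨i, j, a⟩
      have h := be_ne res a
      rcases Nat.eq_zero_or_pos i with rfl | hi
      · rw [h0] at h
        simp only [ne_eq, ite_eq_right_iff, one_ne_zero, imp_false, not_not] at h
        simp [h]
      · have := hlin i hi j h
        simp only
        omega
    intro a b
    rw [Hm_iff]
    by_cases hb : b.1 = a.1 + 1
    · have ha0 := hnn a
      have hb0 := hnn b
      obtain ⟨i, j, a⟩ := a
      obtain ⟨i', j', b⟩ := b
      simp only at hb ha0 hb0
      subst hb
      rw [mA_succ]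
      rcases res.graded i j' b j a with h | ⟨m, hm, h⟩
      · exact Or.inl h
      · refine Or.inr ⟨m, rfl, ?_, h⟩
        simp only
        omega
    · exact Or.inl (mA_ne res _ _ hb)
  sq := mA_sq res
  deg_le := by
    rintro ⟨i, j, a⟩
    have h := be_ne res a
    rcases Nat.eq_zero_or_pos i with rfl | hi
    · rw [h0] at h
      simp only [ne_eq, ite_eq_right_iff, one_ne_zero, imp_false, not_not] at h
      simp [h]
    · have := hlin i hi j h
      simp only
      omega

lemma bridge (h0 : ∀ j : ℤ, res.β 0 j = if j = 0 then 1 else 0)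
    (hlin : ∀ i : ℕ, 1 ≤ i → ∀ j : ℤ, res.β i j ≠ 0 → j = (D : ℤ) + i)
    (p : ℕ) (hlen : ∀ i, p < i → res.β i = 0) (hp : res.β p ≠ 0) :
    ∃ (ι : Type) (_ : Fintype ι) (C : Cx k n D ι) (a0 : ι), C.R1 a0 ∧ C.lin ∧ C.exF ∧ C.J a0 = I ∧
      (∀ i, C.bet i = res.tB i) ∧ Nonempty (AB (k := k) n (MvPolynomial (Fin n) k ⧸ I) ι p) := by
  classical
  have := Ix_finite res p hlen
  letI := Fintype.ofFinite (Ix res)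
  have hsm : ∀ (f : MvPolynomial (Fin n) k) (m : MvPolynomial (Fin n) k ⧸ I), f • m = Ideal.Quotient.mk I f * m := by
    intro f m
    obtain ⟨x, rfl⟩ := Ideal.Quotient.mk_surjective m
    rfl
  have h00 : res.β 0 0 = 1 := by simp [h0]
  let x0 : (j : ℤ) × Fin (res.β 0 j) := ⟨0, ⟨0, by omega⟩⟩
  have hx0 : ∀ x : (j : ℤ) × Fin (res.β 0 j), x = x0 := by
    rintro ⟨j, a⟩
    have h := be_ne res a
    rw [h0] at h
    simp only [ne_eq, ite_eq_right_iff, one_ne_zero, imp_false, not_not] at h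
    subst h
    have : a = ⟨0, by omega⟩ := by
      ext
      have := a.2
      simp only
      omega
    rw [this]
  have hR1 : (toCx res h0 hlin).R1 ⟨0, x0⟩ := by
    constructor
    · rintro ⟨i, x⟩
      constructor
      · intro h
        have h : i = 0 := h
        subst h
        rw [hx0 x]
      · intro h
        rw [h]
        rfl
    · rfl
  have hz : ∀ v : Ix res → MvPolynomial (Fin n) k, (∀ a, v a ≠ 0 → 0 < a.1) → sl res 0 v = 0 := by
    intro v hv
    ext1 x
    rw [sl_apply]
    by_contra hc
    exact absurd (hv _ hc) (by simp)
  have hcyc : ∀ f, (mA res).mulVec (Pi.single (⟨0, x0⟩ : Ix res) f) = 0 := by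
    intro f
    apply ext_sl
    intro i
    have : sl res (i+1) (Pi.single (⟨0, x0⟩ : Ix res) f) = 0 := by
      ext1 x
      rw [sl_apply, Pi.single_apply, if_neg]
      · rfl
      · intro h
        exact absurd (congrArg Sigma.fst h) (by simp)
    rw [sl_mulVec, this, map_zero, map_zero]
  have hsl : ∀ w : FreeMod (MvPolynomial (Fin n) k) (res.β 0), sl res 0 (Pi.single (⟨0, x0⟩ : Ix res) (w x0)) = w := by
    intro w
    ext1 x
    rw [hx0 x, sl_apply, Pi.single_eq_same]
  have hsingle : ∀ f : MvPolynomial (Fin n) k, sl res 0 (Pi.single (⟨0, x0⟩ : Ix res) f) = f • Finsupp.single x0 1 := by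
    intro f
    rw [← hsl (f • Finsupp.single x0 1)]
    simp
  have hJ : (toCx res h0 hlin).J ⟨0, x0⟩ = I := by
    ext f
    rw [Cx.mem_J]
    have e1 : (∃ z, (toCx res h0 hlin).A.mulVec z ⟨0, x0⟩ = f) ↔ ∃ z, (mA res).mulVec z = Pi.single (⟨0, x0⟩ : Ix res) f := by
      constructor
      · rintro ⟨z, hzz⟩
        have hzz : (mA res).mulVec z ⟨0, x0⟩ = f := hzz
        rw [← mA_exact res _ (hcyc f), hsingle]
        have : f • Finsupp.single x0 1 = res.d 0 (sl res 1 z) := by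
          ext1 x
          rw [hx0 x, ← mA_mulVec, hzz]
          simp
        rw [this, aug_d]
      · rintro ⟨z, hzz⟩
        refine ⟨z, ?_⟩
        show (mA res).mulVec z ⟨0, x0⟩ = f
        rw [hzz, Pi.single_eq_same]
    rw [e1, ← mA_exact res _ (hcyc f), hsingle, map_smul]
    constructor
    · intro h
      obtain ⟨w, hw⟩ := res.augSurj 1
      have hw2 : w = w x0 • Finsupp.single x0 1 := by
        rw [← hsingle, hsl]
      rw [hw2, map_smul] at hw
      have : f • (1 : MvPolynomial (Fin n) k ⧸ I) = 0 := by
        rw [← hw, smul_comm, h, smul_zero]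
      rw [← Ideal.Quotient.eq_zero_iff_mem]
      rw [hsm, mul_one] at this
      exact this
    · intro h
      rw [hsm, Ideal.Quotient.eq_zero_iff_mem.2 h, zero_mul]
  refine ⟨Ix res, inferInstance, toCx res h0 hlin, ⟨0, x0⟩, hR1, ?_, ?_, hJ, ?_, ⟨?_⟩⟩
  · rintro ⟨i, j, a⟩ hi
    have := hlin i hi j (be_ne res a)
    show j.toNat = D + i
    omega
  · intro i hi e v hv hA
    have hA : (mA res).mulVec v = 0 := hA
    refine (mA_exact res v hA).1 ?_
    rw [hz v, map_zero]
    intro a ha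
    have h := (Hm_iff _ _ _ _).1 (hv a)
    rcases h with h | ⟨q, h, -⟩
    · exact absurd h ha
    · have h : a.1 = i := h
      omega
  · intro i
    rw [← cardIx]
    rfl
  · refine
      { A := mA res
        g := fun a => a.1
        hg := fun a b h => by
          by_contra hc
          exact h (mA_ne res a b hc)
        sq := mA_sq res
        cc := ?_
        π := res.aug ∘ₗ sl res 0
        H := fun v hv => mA_exact res v hv
        surj := ?_
        pos := ?_
        top := ?_ }
    · rintro ⟨i, j, a⟩ ⟨i', j', b⟩
      by_cases hb : i' = i + 1
      · subst hb
        rw [mA_succ]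
        rcases res.graded i j' b j a with h | ⟨m, hm, h⟩
        · rw [h, map_zero]
        · by_contra hc
          have h2 := res.minimal i j' b j a (fun h3 => hc (by rw [h3, map_zero]))
          rw [constantCoeff_eq] at hc
          have := (hom_iff.1 h) 0 hc
          simp at this
          omega
      · rw [mA_ne res _ _ hb, map_zero]
    · intro m
      obtain ⟨w, rfl⟩ := res.augSurj m
      exact ⟨_, hcyc (w x0), by rw [LinearMap.comp_apply, hsl]⟩
    · intro v hv
      rw [LinearMap.comp_apply, hz v hv, map_zero]
    · obtain ⟨j, hj⟩ := Function.ne_iff.1 hp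
      exact ⟨⟨p, j, ⟨0, Nat.pos_of_ne_zero hj⟩⟩, rfl⟩

end br
end BB

end

section
open MvPolynomial

namespace BB

set_option linter.unusedSectionVars false

section ar

lemma ch_term (D t s : ℕ) : (D+(t+s)).choose (t+s) * (t+s).choose t = (D+t).choose t * (D+(t+s)).choose s := by
  have h := Nat.choose_mul (n := D+(t+s)) (k := t+s) (s := s) (by omega)
  have h1 : (t+s).choose t = (t+s).choose s := by
    rw [← Nat.choose_symm (show s ≤ t+s by omega)]; congr 1; omega
  rw [h1, h, mul_comm]
  congr 2 <;> omega

lemma ch_sum (D t r : ℕ) : ∑ j ∈ Finset.range (t+1+r), (D+j).choose j * j.choose t =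
    (D+t).choose t * (D+(t+1+r)).choose r := by
  induction r with
  | zero =>
    rw [add_zero, Finset.sum_range_succ, Finset.sum_eq_zero]
    · simp
    · intro j hj
      rw [Nat.choose_eq_zero_of_lt (Finset.mem_range.1 hj), mul_zero]
  | succ r ih =>
    rw [← add_assoc, Finset.sum_range_succ, ih]
    have := ch_term D t (r+1)
    rw [show t + (r+1) = t+1+r by ring] at this
    rw [this, ← mul_add, ← Nat.choose_succ_succ]
    rfl

lemma ch_sum1 (p t : ℕ) : ∑ j ∈ Finset.range p, j.choose t = p.choose (t+1) := by
  induction p with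
  | zero => simp
  | succ p ih => rw [Finset.sum_range_succ, ih, Nat.choose_succ_succ, add_comm]


lemma b_le_bt {n : ℕ} {b bt : ℕ → ℕ}
    (hb : ∀ t, bt (t+1) = ∑ j ∈ Finset.range n, b j * j.choose t) {j : ℕ} (hj : j < n) : b j ≤ bt (j+1) := by
  rw [hb]
  calc b j = b j * j.choose j := by simp
    _ ≤ _ := Finset.single_le_sum (f := fun i => b i * i.choose j) (fun _ _ => Nat.zero_le _) (Finset.mem_range.2 hj)

lemma bt_eq {n p : ℕ} {b bt : ℕ → ℕ} (hpn : p ≤ n)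
    (hb : ∀ t, bt (t+1) = ∑ j ∈ Finset.range n, b j * j.choose t)
    (hz : ∀ i, p < i → bt i = 0) (t : ℕ) : bt (t+1) = ∑ j ∈ Finset.range p, b j * j.choose t := by
  rw [hb]
  symm
  refine Finset.sum_subset (Finset.range_subset_range.2 hpn) ?_
  intro j h1 h2
  rw [Finset.mem_range] at h1 h2
  have := b_le_bt hb h1
  rw [hz (j+1) (by omega)] at this
  rw [Nat.le_zero.1 this, zero_mul]

lemma full_step (D j : ℕ) : (j+1) * (D+(j+1)).choose (j+1) = (D+1+j) * (D+j).choose j := by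
  have := Nat.add_one_mul_choose_eq (D+j) j
  rw [show D+1+j = D+j+1 by ring, this, mul_comm]
  rfl

lemma arith {D n p c : ℕ} {b bt : ℕ → ℕ} (hpn : p ≤ n) (hc : 2 ≤ c) (hcn : c ≤ n)
    (hb : ∀ t, bt (t+1) = ∑ j ∈ Finset.range n, b j * j.choose t)
    (hr : ∀ j, j+1 < n → (j+1) * b (j+1) ≤ (D+1+j) * b j)
    (hz : ∀ i, p < i → bt i = 0) (hp : bt p ≠ 0)
    (hle : ∀ j, j < n → b j ≤ (D+j).choose j)
    (hfc : ∀ j < c, b j = (D+j).choose j) (d : ℕ) (hd : d = D + 1) (cm : Prop)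
    (hcm : cm → ∀ j < p, b j = (D+j).choose j) :
    (∀ t : ℕ, 1 ≤ t → t ≤ p →
      max (Nat.choose p t)
          (Nat.choose (d + t - 2) (t - 1) *
            (if t ≤ c then Nat.choose (d + c - 1) (c - t) else 0)) ≤ bt t ∧
      bt t ≤ Nat.choose (d + t - 2) (t - 1) * Nat.choose (d + p - 1) (p - t)) ∧
    ((∃ t : ℕ, 1 ≤ t ∧ t ≤ p ∧
        bt t = Nat.choose (d + t - 2) (t - 1) * Nat.choose (d + p - 1) (p - t)) ↔
      (∀ t : ℕ, 1 ≤ t → t ≤ p →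
        bt t = Nat.choose (d + t - 2) (t - 1) * Nat.choose (d + p - 1) (p - t))) ∧
    (cm → ∀ t : ℕ, 1 ≤ t → t ≤ p →
        bt t = Nat.choose (d + t - 2) (t - 1) * Nat.choose (d + p - 1) (p - t)) := by
  have hcp : c ≤ p := by
    by_contra h
    have h1 := b_le_bt hb (show c - 1 < n by omega)
    rw [hz _ (by omega), hfc _ (by omega)] at h1
    exact absurd (Nat.choose_pos (show c - 1 ≤ D + (c-1) by omega)) (by omega)
  have hbt := bt_eq hpn hb hz
  have hform : ∀ q t, 1 ≤ t → t ≤ q → ∑ j ∈ Finset.range q, (D+j).choose j * j.choose (t-1) =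
      Nat.choose (d + t - 2) (t - 1) * Nat.choose (d + q - 1) (q - t) := by
    intro q t h1 h2
    have := ch_sum D (t-1) (q-t)
    rw [show t - 1 + 1 + (q-t) = q by omega] at this
    rw [this, hd]
    congr 2 <;> omega
  have hbt' : ∀ t, 1 ≤ t → bt t = ∑ j ∈ Finset.range p, b j * j.choose (t-1) := by
    intro t ht
    rw [← hbt, Nat.sub_add_cancel ht]
  have htop : b (p-1) ≠ 0 := by
    intro h0
    apply hp
    rw [hbt' p (by omega)]
    refine Finset.sum_eq_zero fun j hj => ?_
    rw [Finset.mem_range] at hj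
    by_cases h : j = p - 1
    · rw [h, h0, zero_mul]
    · rw [Nat.choose_eq_zero_of_lt (show j < p - 1 by omega), mul_zero]
  have hpos : ∀ s j, j + s = p - 1 → 1 ≤ b j := by
    intro s
    induction s with
    | zero => intro j hj; rw [show j = p - 1 by omega]; omega
    | succ s ih =>
      intro j hj
      have h1 := ih (j+1) (by omega)
      have h2 := hr j (by omega)
      by_contra h3
      rw [show b j = 0 by omega, mul_zero] at h2
      have : 0 < (j+1) * b (j+1) := by positivity
      omega
  have hall : (∀ j < p, b j = (D+j).choose j) → ∀ t : ℕ, 1 ≤ t → t ≤ p →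
        bt t = Nat.choose (d + t - 2) (t - 1) * Nat.choose (d + p - 1) (p - t) := by
    intro h t h1 h2
    rw [← hform p t h1 h2, hbt' t h1]
    exact Finset.sum_congr rfl fun j hj => by rw [h j (Finset.mem_range.1 hj)]
  refine ⟨?_, ⟨?_, ?_⟩, fun h => hall (hcm h)⟩
  · intro t h1 h2
    refine ⟨max_le ?_ ?_, ?_⟩
    · have := ch_sum1 p (t-1)
      rw [Nat.sub_add_cancel h1] at this
      rw [← this, hbt' t h1]
      refine Finset.sum_le_sum fun j hj => ?_
      rw [Finset.mem_range] at hj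
      exact Nat.le_mul_of_pos_left _ (hpos (p-1-j) j (by omega))
    · split_ifs with h
      · rw [← hform c t h1 h, hbt' t h1]
        calc _ = ∑ j ∈ Finset.range c, b j * j.choose (t-1) :=
              Finset.sum_congr rfl fun j hj => by rw [hfc j (Finset.mem_range.1 hj)]
          _ ≤ _ := Finset.sum_le_sum_of_subset (Finset.range_subset_range.2 hcp)
      · simp
    · rw [← hform p t h1 h2, hbt' t h1]
      refine Finset.sum_le_sum fun j hj => ?_
      rw [Finset.mem_range] at hj
      exact Nat.mul_le_mul_right _ (hle j (by omega))
  · rintro ⟨t, h1, h2, h3⟩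
    apply hall
    rw [← hform p t h1 h2, hbt' t h1, Finset.sum_eq_sum_iff_of_le] at h3
    · have h4 := h3 (p-1) (Finset.mem_range.2 (by omega))
      have h5 := Nat.eq_of_mul_eq_mul_right (Nat.choose_pos (by omega)) h4
      have : ∀ s j, j + s = p - 1 → b j = (D+j).choose j := by
        intro s
        induction s with
        | zero => intro j hj; rw [show j = p - 1 by omega]; exact h5
        | succ s ih =>
          intro j hj
          have h6 := ih (j+1) (by omega)
          have h7 := hr j (by omega)
          rw [h6, full_step] at h7
          exact le_antisymm (hle j (by omega)) (Nat.le_of_mul_le_mul_left h7 (by omega))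
      intro j hj
      exact this (p-1-j) j (by omega)
    · intro j hj
      rw [Finset.mem_range] at hj
      exact Nat.mul_le_mul_right _ (hle j (by omega))
  · intro h
    exact ⟨1, le_rfl, by omega, h 1 le_rfl (by omega)⟩
end ar

lemma d_pos {k : Type} [Field k] {n : ℕ} {I : Ideal (MvPolynomial (Fin n) k)} {d : ℕ}
    (hgen : ∃ G : Set (MvPolynomial (Fin n) k),
      (∀ g ∈ G, MvPolynomial.IsHomogeneous g d) ∧ Ideal.span G = I) (hI : I ≠ ⊤)
    (hI2 : idealHeight I ≠ 0) : d ≠ 0 := by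
  rintro rfl
  obtain ⟨G, hG, hs⟩ := hgen
  have hbot : I = ⊥ := by
    rw [← hs, Ideal.span_eq_bot]
    intro g hg
    by_contra hne
    apply hI
    have h1 := hG g hg
    rw [← totalDegree_zero_iff_isHomogeneous, totalDegree_eq_zero_iff_eq_C] at h1
    refine Ideal.eq_top_of_isUnit_mem (x := g) I (by rw [← hs]; exact Ideal.subset_span hg) ?_
    rw [h1]
    refine IsUnit.map C (isUnit_iff_ne_zero.2 fun h => hne ?_)
    rw [h1, h, map_zero]
  apply hI2
  rw [hbot]
  unfold idealHeight
  rw [← le_zero_iff]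
  refine iInf₂_le_of_le ⟨⊥, Ideal.isPrime_bot⟩ bot_le ?_
  rw [le_zero_iff, Order.height_eq_zero]
  intro P _
  exact bot_le (a := P.asIdeal)

end BB

end

/-- Let `I ⊂ S` be a homogeneous ideal generated in degree `d`, of height
`c ≥ 2` and projective dimension `p`, with a `d`-linear free resolution.  Then for all
`1 ≤ t ≤ p`,
`max { C(p,t), C(d+t−2, t−1)·C(d+c−1, c−t) } ≤ β_t(S/I) ≤ C(d+t−2, t−1)·C(d+p−1, p−t) = C_t`
(where the term `C(d+c−1, c−t)` is interpreted as `0` when `t > c`).  Moreover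
`β_t(S/I) = C_t` for some `t` iff `β_t(S/I) = C_t` for all `t`; and if `S/I` is
Cohen–Macaulay then `β_t(S/I) = C_t` for all `t`. -/
theorem betti_bounds_linear_resolution
    (k : Type) [Field k] (n : ℕ) (I : Ideal (MvPolynomial (Fin n) k)) (d : ℕ)
    (hgen : ∃ G : Set (MvPolynomial (Fin n) k),
      (∀ g ∈ G, MvPolynomial.IsHomogeneous g d) ∧ Ideal.span G = I)
    (res : MinGradedFreeRes (MvPolynomial (Fin n) k)
      (fun m => {f | MvPolynomial.IsHomogeneous f m})
      (MvPolynomial (Fin n) k ⧸ I))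
    (h0 : ∀ j : ℤ, res.β 0 j = if j = 0 then 1 else 0)
    (h1 : ∀ j : ℤ, res.β 1 j ≠ 0 → j = (d : ℤ))
    (p : ℕ) (hlen : ∀ i, p < i → res.β i = 0) (hp : res.β p ≠ 0)
    (c : ℕ) (hc : 2 ≤ c) (hht : idealHeight I = (c : ℕ∞))
    (hlin : ∀ i : ℕ, 1 ≤ i → ∀ j : ℤ, res.β i j ≠ 0 → j = (d : ℤ) + i - 1) :
    (∀ t : ℕ, 1 ≤ t → t ≤ p →
      max (Nat.choose p t)
          (Nat.choose (d + t - 2) (t - 1) *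
            (if t ≤ c then Nat.choose (d + c - 1) (c - t) else 0)) ≤ res.tB t ∧
      res.tB t ≤ Nat.choose (d + t - 2) (t - 1) * Nat.choose (d + p - 1) (p - t)) ∧
    ((∃ t : ℕ, 1 ≤ t ∧ t ≤ p ∧
        res.tB t = Nat.choose (d + t - 2) (t - 1) * Nat.choose (d + p - 1) (p - t)) ↔
      (∀ t : ℕ, 1 ≤ t → t ≤ p →
        res.tB t = Nat.choose (d + t - 2) (t - 1) * Nat.choose (d + p - 1) (p - t))) ∧
    (moduleDim k n (MvPolynomial (Fin n) k ⧸ I) =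
        ((gradedDepth k n (MvPolynomial (Fin n) k ⧸ I) : ℕ∞) : WithBot ℕ∞) →
      ∀ t : ℕ, 1 ≤ t → t ≤ p →
        res.tB t = Nat.choose (d + t - 2) (t - 1) * Nat.choose (d + p - 1) (p - t)) := by
  have hI : I ≠ ⊤ := by
    rintro rfl
    have : idealHeight (⊤ : Ideal (MvPolynomial (Fin n) k)) = ⊤ := by
      unfold idealHeight
      rw [iInf₂_eq_top]
      intro P hP
      exact absurd (top_le_iff.1 hP) P.2.ne_top
    rw [this] at hht
    exact ENat.top_ne_natCast c hht
  have hd : d ≠ 0 := BB.d_pos hgen hI (by rw [hht]; norm_cast; omega)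
  obtain ⟨D, rfl⟩ := Nat.exists_eq_succ_of_ne_zero hd
  obtain ⟨ι, _, C, a0, hR, hL, hE, hJ, hbet, ⟨X⟩⟩ := BB.bridge (D := D) res h0
    (fun i hi j hj => by have := hlin i hi j hj; push_cast at this; omega) p hlen hp
  obtain ⟨b, hP, hb, hr, hb0⟩ := BB.Cx.numeric hR hL hE
  have hpn := X.le
  have hg := fun q hq => BB.Cx.growth (q := q) hR hP hr hb0 (by rw [hJ]; exact hI) hq
  have hfc := hg c (by
    intro s hs
    rw [hJ] at hs
    refine BB.dim_quot_le I ?_ hs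
    intro P hP
    rw [← hht]
    exact iInf₂_le P hP)
  refine BB.arith (D := D) (n := n) (b := b) (bt := res.tB) hpn hc hfc.1 ?_ hr ?_ ?_
    (BB.Cx.b_le hr hb0) hfc.2 _ rfl _ ?_
  · intro t
    rw [← hbet, hb]
  · intro i hi
    unfold MinGradedFreeRes.tB
    refine Finset.sum_eq_zero fun j _ => ?_
    rw [hlen i hi]
    rfl
  · obtain ⟨j, hj⟩ := Function.ne_iff.1 hp
    have : res.β p j ≤ res.tB p :=
      Finset.single_le_sum (f := fun j => res.β p j) (fun _ _ => Nat.zero_le _) (by simpa using hj)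
    have hj : res.β p j ≠ 0 := hj
    omega
  · intro hcm
    refine (hg p ?_).2
    intro s hs
    rw [hJ] at hs
    unfold moduleDim at hcm
    rw [Ideal.annihilator_quotient] at hcm
    rw [hcm] at hs
    have hs : (s : ℕ∞) ≤ gradedDepth k n (MvPolynomial (Fin n) k ⧸ I) := by exact_mod_cast hs
    have h2 : gradedDepth k n (MvPolynomial (Fin n) k ⧸ I) ≤ ((n - p : ℕ) : ℕ∞) := by
      refine sSup_le ?_
      rintro r ⟨rs, rfl, h3, h4⟩
      have := BB.AB.reg rs _ _ _ X h3 h4.toIsWeaklyRegular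
      norm_cast
      omega
    have h5 := hs.trans h2
    norm_cast at h5
    omega
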